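/- There exist hsops of I_6 (the ring of invariants of the binary sextic) with each of the degree sequences (2, 4, 6, 10), (2, 4, 6, 15), and (2, 4, 10, 15). -/

import Mathlib

set_option synthInstance.maxHeartbeats 1000000
noncomputable section

open MvPolynomial

/-- The binary form of degree `n` with coefficient vector `a`, as a polynomial in two
variables `X 0 = x`, `X 1 = y`. -/
def formPoly (n : ℕ) (a : Fin (n+1) → ℂ) : MvPolynomial (Fin 2) ℂ :=
  ∑ i : Fin (n+1), C (a i) * X 0 ^ (n - (i : ℕ)) * X 1 ^ (i : ℕ)

/-- The action of `SL(2,ℂ)` on coefficient vectors of binary forms of degree `n`,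
given by linear substitution of the variables `x`, `y`. -/
def sl2Act (n : ℕ) (g : Matrix.SpecialLinearGroup (Fin 2) ℂ) (a : Fin (n+1) → ℂ) :
    Fin (n+1) → ℂ := fun i =>
  coeff (Finsupp.single 0 (n - (i : ℕ)) + Finsupp.single 1 (i : ℕ))
    (bind₁ (fun j : Fin 2 => C (g.1 j 0) * X 0 + C (g.1 j 1) * X 1) (formPoly n a))

/-- The ring of invariants `I_n` of the binary form of degree `n`: the subalgebra of
`ℂ[a_0,…,a_n]` of polynomials invariant under the `SL(2,ℂ)`-action. -/
def invariantRing (n : ℕ) : Subalgebra ℂ (MvPolynomial (Fin (n+1)) ℂ) where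
  carrier := {p | ∀ g : Matrix.SpecialLinearGroup (Fin 2) ℂ, ∀ a : Fin (n+1) → ℂ,
    eval (sl2Act n g a) p = eval a p}
  mul_mem' := by
    intro p q hp hq g a
    simp only [Set.mem_setOf_eq, map_mul] at *
    rw [hp g a, hq g a]
  add_mem' := by
    intro p q hp hq g a
    simp only [Set.mem_setOf_eq, map_add] at *
    rw [hp g a, hq g a]
  algebraMap_mem' := by
    intro c g a
    simp

/-- `IsHSOP n d p` says that `p` is a homogeneous system of parameters of the invariant
ring of the binary form of degree `n`, with degree sequence `d` : the `p k` are
homogeneous of positive degrees `d k`, algebraically independent over `ℂ`, and `I_n` is a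
finitely generated module over the subalgebra they generate. -/
def IsHSOP (n : ℕ) (d : Fin (n-2) → ℕ) (p : Fin (n-2) → invariantRing n) : Prop :=
  (∀ k, 0 < d k) ∧
  (∀ k, ((p k : MvPolynomial (Fin (n+1)) ℂ)).IsHomogeneous (d k)) ∧
  AlgebraicIndependent ℂ p ∧
  Module.Finite (Algebra.adjoin ℂ (Set.range p)) (invariantRing n)

theorem coeff_formPoly (n : ℕ) (a : Fin (n + 1) → ℂ) (i : Fin (n + 1)) :
    coeff (Finsupp.single 0 (n - (i : ℕ)) + Finsupp.single 1 (i : ℕ)) (formPoly n a) = a i := by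
  unfold formPoly
  have hX (k : ℕ) : (X 0 ^ (n - k) * X 1 ^ k : MvPolynomial (Fin 2) ℂ) =
      monomial (Finsupp.single 0 (n - k) + Finsupp.single 1 k) 1 := by
    simp [X_pow_eq_monomial, monomial_mul]
  rw [coeff_sum, Finset.sum_eq_single i]
  · rw [mul_assoc, coeff_C_mul, hX]
    simp
  · intro j _ hj
    rw [mul_assoc, coeff_C_mul, hX, coeff_monomial, if_neg, mul_zero]
    intro h
    have := DFunLike.congr_fun h 1
    simp at this
    exact hj (Fin.ext this)
  · simp

theorem formPoly_injective (n : ℕ) : Function.Injective (formPoly n) := fun a b h => by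
  funext i
  rw [← coeff_formPoly n a i, h, coeff_formPoly]

theorem isHomogeneous_formPoly (n : ℕ) (a : Fin (n + 1) → ℂ) :
    (formPoly n a).IsHomogeneous n := by
  refine IsHomogeneous.sum _ _ _ fun i _ => ?_
  have := ((isHomogeneous_C (Fin 2) (a i)).mul (isHomogeneous_X_pow (R := ℂ) (0 : Fin 2)
    (n - (i : ℕ)))).mul (isHomogeneous_X_pow (R := ℂ) (1 : Fin 2) (i : ℕ))
  convert this using 1
  omega

theorem MvPolynomial.IsHomogeneous.eq_formPoly {n : ℕ} {q : MvPolynomial (Fin 2) ℂ}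
    (hq : q.IsHomogeneous n) :
    q = formPoly n fun i =>
      coeff (Finsupp.single 0 (n - (i : ℕ)) + Finsupp.single 1 (i : ℕ)) q := by
  ext m
  by_cases hm : m.degree = n
  · have h2 : m 0 + m 1 = n := by
      rw [← hm, Finsupp.degree_eq_sum, Fin.sum_univ_two]
    have : m = Finsupp.single 0 (n - ((⟨m 1, by omega⟩ : Fin (n + 1)) : ℕ)) +
        Finsupp.single 1 (((⟨m 1, by omega⟩ : Fin (n + 1)) : ℕ)) := by
      ext j
      fin_cases j
      · simp; omega
      · simp
    rw [this, coeff_formPoly]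
  · rw [hq.coeff_eq_zero hm, (isHomogeneous_formPoly n _).coeff_eq_zero hm]

/-- The linear substitution of variables attached to `g`. -/
def linSubst (g : Matrix.SpecialLinearGroup (Fin 2) ℂ) :
    MvPolynomial (Fin 2) ℂ →ₐ[ℂ] MvPolynomial (Fin 2) ℂ :=
  bind₁ fun j : Fin 2 => C (g.1 j 0) * X 0 + C (g.1 j 1) * X 1

theorem formPoly_sl2Act (n : ℕ) (g : Matrix.SpecialLinearGroup (Fin 2) ℂ)
    (a : Fin (n + 1) → ℂ) : formPoly n (sl2Act n g a) = linSubst g (formPoly n a) := by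
  have h : (linSubst g (formPoly n a)).IsHomogeneous n := by
    have := (isHomogeneous_formPoly n a).aeval
      (fun j : Fin 2 => C (g.1 j 0) * X 0 + C (g.1 j 1) * X 1 : Fin 2 → MvPolynomial (Fin 2) ℂ)
      (n := 1) fun j => by
        refine IsHomogeneous.add ?_ ?_
        · simpa using (isHomogeneous_C (Fin 2) (g.1 j 0)).mul (isHomogeneous_X ℂ (0 : Fin 2))
        · simpa using (isHomogeneous_C (Fin 2) (g.1 j 1)).mul (isHomogeneous_X ℂ (1 : Fin 2))
    rw [one_mul] at this
    exact this
  have hact : sl2Act n g a = fun i : Fin (n + 1) =>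
      coeff (Finsupp.single 0 (n - (i : ℕ)) + Finsupp.single 1 (i : ℕ))
        (linSubst g (formPoly n a)) := by
    funext i
    have hcomp : (bind₁ fun j : Fin 2 => (C (g.1 j 0) * X 0 + C (g.1 j 1) * X 1 :
        MvPolynomial ℕ ℂ)) = (rename Fin.val).comp (linSubst g) := by
      apply MvPolynomial.algHom_ext
      intro j
      simp [linSubst]
    have hexp : (Finsupp.single 0 (n - (i : ℕ)) + Finsupp.single 1 (i : ℕ) : ℕ →₀ ℕ) =
        Finsupp.mapDomain Fin.val
          (Finsupp.single (0 : Fin 2) (n - (i : ℕ)) + Finsupp.single 1 (i : ℕ)) := by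
      rw [Finsupp.mapDomain_add, Finsupp.mapDomain_single, Finsupp.mapDomain_single]
      rfl
    unfold sl2Act
    rw [hcomp, AlgHom.comp_apply, hexp, coeff_rename_mapDomain _ Fin.val_injective]
  rw [hact]
  exact h.eq_formPoly.symm

theorem sl2Act_eq_iff {n : ℕ} {g : Matrix.SpecialLinearGroup (Fin 2) ℂ} {a b : Fin (n + 1) → ℂ} :
    sl2Act n g a = b ↔ linSubst g (formPoly n a) = formPoly n b := by
  rw [← formPoly_sl2Act]
  exact (formPoly_injective n).eq_iff.symm

theorem sl2Act_mul (n : ℕ) (g h : Matrix.SpecialLinearGroup (Fin 2) ℂ) (a : Fin (n + 1) → ℂ) :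
    sl2Act n (g * h) a = sl2Act n h (sl2Act n g a) := by
  rw [sl2Act_eq_iff, formPoly_sl2Act, formPoly_sl2Act]
  have : linSubst (g * h) = (linSubst h).comp (linSubst g) := by
    apply MvPolynomial.algHom_ext
    intro j
    simp only [linSubst, bind₁_X_right, AlgHom.comp_apply, map_add, map_mul, algHom_C,
      Matrix.SpecialLinearGroup.coe_mul, Matrix.mul_apply, Fin.sum_univ_two, algebraMap_eq]
    ring
  rw [this, AlgHom.comp_apply]

/-- The upper unipotent substitution `x ↦ x + b y`. -/
def upperUnip (b : ℂ) : Matrix.SpecialLinearGroup (Fin 2) ℂ :=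
  ⟨!![1, b; 0, 1], by simp⟩

/-- The Weyl element `x ↦ y`, `y ↦ -x`. -/
def weylElt : Matrix.SpecialLinearGroup (Fin 2) ℂ :=
  ⟨!![0, 1; -1, 0], by simp⟩

theorem coe_upperUnip (b : ℂ) : (upperUnip b).1 = !![1, b; 0, 1] := rfl

theorem coe_weylElt : weylElt.1 = !![0, 1; -1, 0] := rfl

theorem sl2_induction {P : Matrix.SpecialLinearGroup (Fin 2) ℂ → Prop}
    (hmul : ∀ g h, P g → P h → P (g * h)) (hU : ∀ b, P (upperUnip b)) (hW : P weylElt)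
    (g : Matrix.SpecialLinearGroup (Fin 2) ℂ) : P g := by
  have key : ∀ g : Matrix.SpecialLinearGroup (Fin 2) ℂ, g.1 1 0 ≠ 0 → P g := by
    intro g hg
    have hdet := g.2
    rw [Matrix.det_fin_two] at hdet
    have h3 : P (weylElt * weylElt * weylElt) := hmul _ _ (hmul _ _ hW hW) hW
    have : g = upperUnip ((g.1 0 0 - 1) / g.1 1 0) *
        (weylElt * upperUnip (-(g.1 1 0)) * (weylElt * weylElt * weylElt)) *
        upperUnip ((g.1 1 1 - 1) / g.1 1 0) := by
      ext i j
      fin_cases i <;> fin_cases j <;>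
        simp [coe_upperUnip, coe_weylElt, Matrix.SpecialLinearGroup.coe_mul, Matrix.mul_apply,
          Fin.sum_univ_two]
      all_goals field_simp
      all_goals first | ring1 | linear_combination -hdet
    rw [this]
    exact hmul _ _ (hmul _ _ (hU _) (hmul _ _ (hmul _ _ hW (hU _)) h3)) (hU _)
  by_cases hg : g.1 1 0 = 0
  · have h2 : g = g * weylElt * (weylElt * weylElt * weylElt) := by
      ext i j
      fin_cases i <;> fin_cases j <;>
        simp [coe_weylElt, Matrix.SpecialLinearGroup.coe_mul, Matrix.mul_apply, Fin.sum_univ_two]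
    have h4 : P (g * weylElt) := by
      apply key
      have hdet := g.2
      rw [Matrix.det_fin_two, hg] at hdet
      have : g.1 1 1 ≠ 0 := by rintro h; simp [h] at hdet
      simpa [coe_weylElt, Matrix.SpecialLinearGroup.coe_mul, Matrix.mul_apply, Fin.sum_univ_two]
        using this
    rw [h2]
    exact hmul _ _ h4 (hmul _ _ (hmul _ _ hW hW) hW)
  · exact key g hg

theorem mem_invariantRing_of_generators {n : ℕ} {p : MvPolynomial (Fin (n + 1)) ℂ}
    (hU : ∀ b a, eval (sl2Act n (upperUnip b) a) p = eval a p)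
    (hW : ∀ a, eval (sl2Act n weylElt a) p = eval a p) : p ∈ invariantRing n := by
  intro g
  refine sl2_induction (P := fun g => ∀ a, eval (sl2Act n g a) p = eval a p) ?_ hU hW g
  intro g h hg hh a
  rw [sl2Act_mul, hh, hg]

theorem sl2Act_upperUnip (b : ℂ) (a : Fin 7 → ℂ) :
    sl2Act 6 (upperUnip b) a = ![a 0, a 1 + 6 * b * a 0, a 2 + 5 * b * a 1 + 15 * b ^ 2 * a 0,
      a 3 + 4 * b * a 2 + 10 * b ^ 2 * a 1 + 20 * b ^ 3 * a 0,
      a 4 + 3 * b * a 3 + 6 * b ^ 2 * a 2 + 10 * b ^ 3 * a 1 + 15 * b ^ 4 * a 0,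
      a 5 + 2 * b * a 4 + 3 * b ^ 2 * a 3 + 4 * b ^ 3 * a 2 + 5 * b ^ 4 * a 1 + 6 * b ^ 5 * a 0,
      a 6 + b * a 5 + b ^ 2 * a 4 + b ^ 3 * a 3 + b ^ 4 * a 2 + b ^ 5 * a 1 + b ^ 6 * a 0] := by
  rw [sl2Act_eq_iff]
  simp [formPoly, Fin.sum_univ_succ, linSubst, coe_upperUnip, map_ofNat]
  ring

theorem sl2Act_weylElt (a : Fin 7 → ℂ) :
    sl2Act 6 weylElt a = ![a 6, -a 5, a 4, -a 3, a 2, -a 1, a 0] := by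
  rw [sl2Act_eq_iff]
  simp [formPoly, Fin.sum_univ_succ, linSubst, coe_weylElt]
  ring
section Covariants

variable {R S : Type*} [CommRing R] [CommRing S]

/-- Sixty times the coefficients of a sextic with respect to the basis
`(6 choose i) x ^ (6 - i) y ^ i`. -/
def scaledCoef (a : Fin 7 → R) : Fin 7 → R :=
  ![60 * a 0, 10 * a 1, 4 * a 2, 3 * a 3, 4 * a 4, 10 * a 5, 60 * a 6]

/-- The quartic covariant of degree two, in binomial normalization. -/
def quarticCov (a : Fin 7 → R) : Fin 5 → R :=
  ![6 * (a 0 * a 4 - 4 * a 1 * a 3 + 3 * a 2 ^ 2),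
    3 * (a 0 * a 5 - 3 * a 1 * a 4 + 2 * a 2 * a 3),
    a 0 * a 6 - 9 * a 2 * a 4 + 8 * a 3 ^ 2,
    3 * (a 1 * a 6 - 3 * a 2 * a 5 + 2 * a 3 * a 4),
    6 * (a 2 * a 6 - 4 * a 3 * a 5 + 3 * a 4 ^ 2)]

/-- The fourth transvectant of a sextic and a quartic. -/
def transvectFour (a : Fin 7 → R) (i : Fin 5 → R) : Fin 3 → R :=
  ![a 0 * i 4 - 4 * a 1 * i 3 + 6 * a 2 * i 2 - 4 * a 3 * i 1 + a 4 * i 0,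
    a 1 * i 4 - 4 * a 2 * i 3 + 6 * a 3 * i 2 - 4 * a 4 * i 1 + a 5 * i 0,
    a 2 * i 4 - 4 * a 3 * i 3 + 6 * a 4 * i 2 - 4 * a 5 * i 1 + a 6 * i 0]

/-- The second transvectant of a quartic and a quadratic form. -/
def transvectTwo (i : Fin 5 → R) (q : Fin 3 → R) : Fin 3 → R :=
  ![i 2 * q 0 - 2 * i 1 * q 1 + i 0 * q 2,
    i 3 * q 0 - 2 * i 2 * q 1 + i 1 * q 2,
    i 4 * q 0 - 2 * i 3 * q 1 + i 2 * q 2]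

/-- The polarized discriminant of quadratic forms. -/
def quadPair (p q : Fin 3 → R) : R := p 0 * q 2 - 2 * p 1 * q 1 + p 2 * q 0

/-- The determinant of three quadratic forms. -/
def quadDet (l m n : Fin 3 → R) : R :=
  l 0 * (m 1 * n 2 - m 2 * n 1) - l 1 * (m 0 * n 2 - m 2 * n 0) + l 2 * (m 0 * n 1 - m 1 * n 0)

/-- The quadratic covariant of degree three, in terms of scaled coefficients. -/
def quadCovThree (a : Fin 7 → R) : Fin 3 → R := transvectFour a (quarticCov a)

/-- The quadratic covariant of degree five, in terms of scaled coefficients. -/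
def quadCovFive (a : Fin 7 → R) : Fin 3 → R := transvectTwo (quarticCov a) (quadCovThree a)

/-- The quadratic covariant of degree seven, in terms of scaled coefficients. -/
def quadCovSeven (a : Fin 7 → R) : Fin 3 → R := transvectTwo (quarticCov a) (quadCovFive a)

/-- The second-degree invariant of scaled coefficients. -/
def sexticPair (a : Fin 7 → R) : R := a 0 * a 6 - 6 * a 1 * a 5 + 15 * a 2 * a 4 - 10 * a 3 ^ 2

/-- The quadratic invariant of a quartic. -/
def quarticPair (i : Fin 5 → R) : R := i 0 * i 4 - 4 * i 1 * i 3 + 3 * i 2 ^ 2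

/-- The invariant of degree 2 of the sextic. -/
def inv2 (a : Fin 7 → R) : R := sexticPair (scaledCoef a)

/-- An invariant of degree 4 of the sextic. -/
def inv4 (a : Fin 7 → R) : R := quarticPair (quarticCov (scaledCoef a))

/-- An invariant of degree 6 of the sextic. -/
def inv6 (a : Fin 7 → R) : R :=
  quadPair (quadCovThree (scaledCoef a)) (quadCovThree (scaledCoef a))

/-- An invariant of degree 10 of the sextic. -/
def inv10 (a : Fin 7 → R) : R :=
  quadPair (quadCovFive (scaledCoef a)) (quadCovFive (scaledCoef a))

/-- The invariant of degree 15 of the sextic. -/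
def inv15 (a : Fin 7 → R) : R :=
  quadDet (quadCovThree (scaledCoef a)) (quadCovFive (scaledCoef a)) (quadCovSeven (scaledCoef a))

section Equivariance

variable (b : R)

/-- The action of `x ↦ x + b y` on quadratic forms in binomial normalization. -/
def unipTwo (q : Fin 3 → R) : Fin 3 → R :=
  ![q 0, q 1 + b * q 0, q 2 + 2 * b * q 1 + b ^ 2 * q 0]

/-- The action of `x ↦ x + b y` on quartic forms in binomial normalization. -/
def unipFour (q : Fin 5 → R) : Fin 5 → R :=
  ![q 0, q 1 + b * q 0, q 2 + 2 * b * q 1 + b ^ 2 * q 0,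
    q 3 + 3 * b * q 2 + 3 * b ^ 2 * q 1 + b ^ 3 * q 0,
    q 4 + 4 * b * q 3 + 6 * b ^ 2 * q 2 + 4 * b ^ 3 * q 1 + b ^ 4 * q 0]

/-- The action of `x ↦ x + b y` on sextic forms in binomial normalization. -/
def unipSix (q : Fin 7 → R) : Fin 7 → R :=
  ![q 0, q 1 + b * q 0, q 2 + 2 * b * q 1 + b ^ 2 * q 0,
    q 3 + 3 * b * q 2 + 3 * b ^ 2 * q 1 + b ^ 3 * q 0,
    q 4 + 4 * b * q 3 + 6 * b ^ 2 * q 2 + 4 * b ^ 3 * q 1 + b ^ 4 * q 0,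
    q 5 + 5 * b * q 4 + 10 * b ^ 2 * q 3 + 10 * b ^ 3 * q 2 + 5 * b ^ 4 * q 1 + b ^ 5 * q 0,
    q 6 + 6 * b * q 5 + 15 * b ^ 2 * q 4 + 20 * b ^ 3 * q 3 + 15 * b ^ 4 * q 2
      + 6 * b ^ 5 * q 1 + b ^ 6 * q 0]

/-- The action of the Weyl element on quadratic forms. -/
def weylTwo (q : Fin 3 → R) : Fin 3 → R := ![q 2, -q 1, q 0]

/-- The action of the Weyl element on quartic forms. -/
def weylFour (q : Fin 5 → R) : Fin 5 → R := ![q 4, -q 3, q 2, -q 1, q 0]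

/-- The action of the Weyl element on sextic forms. -/
def weylSix (q : Fin 7 → R) : Fin 7 → R := ![q 6, -q 5, q 4, -q 3, q 2, -q 1, q 0]

theorem quarticCov_unipSix (a : Fin 7 → R) :
    quarticCov (unipSix b a) = unipFour b (quarticCov a) := by
  ext k
  fin_cases k <;> simp [quarticCov, unipSix, unipFour] <;> ring

theorem transvectFour_unip (a : Fin 7 → R) (i : Fin 5 → R) :
    transvectFour (unipSix b a) (unipFour b i) = unipTwo b (transvectFour a i) := by
  ext k
  fin_cases k <;> simp [transvectFour, unipSix, unipFour, unipTwo] <;> ring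

theorem transvectTwo_unip (i : Fin 5 → R) (q : Fin 3 → R) :
    transvectTwo (unipFour b i) (unipTwo b q) = unipTwo b (transvectTwo i q) := by
  ext k
  fin_cases k <;> simp [transvectTwo, unipFour, unipTwo] <;> ring

theorem quadPair_unip (p q : Fin 3 → R) :
    quadPair (unipTwo b p) (unipTwo b q) = quadPair p q := by
  simp [quadPair, unipTwo]; ring

theorem quadDet_unip (l m n : Fin 3 → R) :
    quadDet (unipTwo b l) (unipTwo b m) (unipTwo b n) = quadDet l m n := by
  simp [quadDet, unipTwo]; ring

theorem sexticPair_unip (a : Fin 7 → R) : sexticPair (unipSix b a) = sexticPair a := by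
  simp [sexticPair, unipSix]; ring

theorem quarticPair_unip (i : Fin 5 → R) : quarticPair (unipFour b i) = quarticPair i := by
  simp [quarticPair, unipFour]; ring

theorem quarticCov_weylSix (a : Fin 7 → R) :
    quarticCov (weylSix a) = weylFour (quarticCov a) := by
  ext k
  fin_cases k <;> simp [quarticCov, weylSix, weylFour] <;> ring

theorem transvectFour_weyl (a : Fin 7 → R) (i : Fin 5 → R) :
    transvectFour (weylSix a) (weylFour i) = weylTwo (transvectFour a i) := by
  ext k
  fin_cases k <;> simp [transvectFour, weylSix, weylFour, weylTwo] <;> ring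

theorem transvectTwo_weyl (i : Fin 5 → R) (q : Fin 3 → R) :
    transvectTwo (weylFour i) (weylTwo q) = weylTwo (transvectTwo i q) := by
  ext k
  fin_cases k <;> simp [transvectTwo, weylFour, weylTwo] <;> ring

theorem quadPair_weyl (p q : Fin 3 → R) :
    quadPair (weylTwo p) (weylTwo q) = quadPair p q := by
  simp [quadPair, weylTwo]; ring

theorem quadDet_weyl (l m n : Fin 3 → R) :
    quadDet (weylTwo l) (weylTwo m) (weylTwo n) = quadDet l m n := by
  simp [quadDet, weylTwo]; ring

theorem sexticPair_weyl (a : Fin 7 → R) : sexticPair (weylSix a) = sexticPair a := by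
  simp [sexticPair, weylSix]; ring

theorem quarticPair_weyl (i : Fin 5 → R) : quarticPair (weylFour i) = quarticPair i := by
  simp [quarticPair, weylFour]; ring

end Equivariance

section Naturality

variable (f : R →+* S)

theorem map_scaledCoef (a : Fin 7 → R) : scaledCoef (f ∘ a) = f ∘ scaledCoef a := by
  ext k
  fin_cases k <;> simp [scaledCoef, map_ofNat]

theorem map_quarticCov (a : Fin 7 → R) : quarticCov (f ∘ a) = f ∘ quarticCov a := by
  ext k
  fin_cases k <;> simp [quarticCov, map_ofNat]

theorem map_transvectFour (a : Fin 7 → R) (i : Fin 5 → R) :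
    transvectFour (f ∘ a) (f ∘ i) = f ∘ transvectFour a i := by
  ext k
  fin_cases k <;> simp [transvectFour, map_ofNat]

theorem map_transvectTwo (i : Fin 5 → R) (q : Fin 3 → R) :
    transvectTwo (f ∘ i) (f ∘ q) = f ∘ transvectTwo i q := by
  ext k
  fin_cases k <;> simp [transvectTwo, map_ofNat]

theorem map_inv2 (a : Fin 7 → R) : inv2 (f ∘ a) = f (inv2 a) := by
  simp [inv2, map_scaledCoef, sexticPair, map_ofNat]

theorem map_inv4 (a : Fin 7 → R) : inv4 (f ∘ a) = f (inv4 a) := by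
  simp [inv4, map_scaledCoef, map_quarticCov, quarticPair, map_ofNat]

theorem map_inv6 (a : Fin 7 → R) : inv6 (f ∘ a) = f (inv6 a) := by
  simp [inv6, map_scaledCoef, quadCovThree, map_quarticCov, map_transvectFour, quadPair, map_ofNat]

theorem map_inv10 (a : Fin 7 → R) : inv10 (f ∘ a) = f (inv10 a) := by
  simp [inv10, map_scaledCoef, quadCovThree, quadCovFive, map_quarticCov, map_transvectFour,
    map_transvectTwo, quadPair, map_ofNat]

theorem map_inv15 (a : Fin 7 → R) : inv15 (f ∘ a) = f (inv15 a) := by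
  simp [inv15, map_scaledCoef, quadCovThree, quadCovFive, quadCovSeven, map_quarticCov,
    map_transvectFour, map_transvectTwo, quadDet]

end Naturality

end Covariants

theorem scaledCoef_sl2Act_upperUnip (b : ℂ) (a : Fin 7 → ℂ) :
    scaledCoef (sl2Act 6 (upperUnip b) a) = unipSix b (scaledCoef a) := by
  rw [sl2Act_upperUnip]
  ext k
  fin_cases k <;> simp [scaledCoef, unipSix] <;> ring

theorem scaledCoef_sl2Act_weylElt (a : Fin 7 → ℂ) :
    scaledCoef (sl2Act 6 weylElt a) = weylSix (scaledCoef a) := by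
  rw [sl2Act_weylElt]
  ext k
  fin_cases k <;> simp [scaledCoef, weylSix]

theorem eval_of_natural {F : ∀ {R : Type} [CommRing R], (Fin 7 → R) → R}
    (hF : ∀ {R S : Type} [CommRing R] [CommRing S] (f : R →+* S) (a : Fin 7 → R),
      F (f ∘ a) = f (F a)) {S : Type} [CommRing S] [Algebra ℂ S] (a : Fin 7 → S) :
    aeval a (F (X : Fin 7 → MvPolynomial (Fin 7) ℂ)) = F a := by
  have := hF (aeval (R := ℂ) a).toRingHom X
  have h : (aeval (R := ℂ) a).toRingHom ∘ X = a := by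
    funext i
    simp
  rw [h] at this
  exact this.symm

theorem mem_invariantRing_of_natural {F : ∀ {R : Type} [CommRing R], (Fin 7 → R) → R}
    (hF : ∀ {R S : Type} [CommRing R] [CommRing S] (f : R →+* S) (a : Fin 7 → R),
      F (f ∘ a) = f (F a))
    (hU : ∀ (b : ℂ) (a : Fin 7 → ℂ), F (sl2Act 6 (upperUnip b) a) = F a)
    (hW : ∀ a : Fin 7 → ℂ, F (sl2Act 6 weylElt a) = F a) :
    F (X : Fin 7 → MvPolynomial (Fin 7) ℂ) ∈ invariantRing 6 := by
  have h (a : Fin 7 → ℂ) : eval a (F (X : Fin 7 → MvPolynomial (Fin 7) ℂ)) = F a := by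
    rw [← eval_of_natural hF a]
    rfl
  refine mem_invariantRing_of_generators (fun b a => ?_) fun a => ?_
  · rw [h, h, hU]
  · rw [h, h, hW]

theorem inv2_mem : inv2 (X : Fin 7 → MvPolynomial (Fin 7) ℂ) ∈ invariantRing 6 :=
  mem_invariantRing_of_natural map_inv2
    (fun b a => by rw [inv2, scaledCoef_sl2Act_upperUnip, sexticPair_unip, inv2])
    (fun a => by rw [inv2, scaledCoef_sl2Act_weylElt, sexticPair_weyl, inv2])

theorem inv4_mem : inv4 (X : Fin 7 → MvPolynomial (Fin 7) ℂ) ∈ invariantRing 6 :=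
  mem_invariantRing_of_natural map_inv4
    (fun b a => by
      rw [inv4, scaledCoef_sl2Act_upperUnip, quarticCov_unipSix, quarticPair_unip, inv4])
    (fun a => by
      rw [inv4, scaledCoef_sl2Act_weylElt, quarticCov_weylSix, quarticPair_weyl, inv4])

theorem inv6_mem : inv6 (X : Fin 7 → MvPolynomial (Fin 7) ℂ) ∈ invariantRing 6 :=
  mem_invariantRing_of_natural map_inv6
    (fun b a => by
      simp only [inv6, quadCovThree, scaledCoef_sl2Act_upperUnip, quarticCov_unipSix,
        transvectFour_unip, quadPair_unip])
    (fun a => by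
      simp only [inv6, quadCovThree, scaledCoef_sl2Act_weylElt, quarticCov_weylSix,
        transvectFour_weyl, quadPair_weyl])

theorem inv10_mem : inv10 (X : Fin 7 → MvPolynomial (Fin 7) ℂ) ∈ invariantRing 6 :=
  mem_invariantRing_of_natural map_inv10
    (fun b a => by
      simp only [inv10, quadCovFive, quadCovThree, scaledCoef_sl2Act_upperUnip,
        quarticCov_unipSix, transvectFour_unip, transvectTwo_unip, quadPair_unip])
    (fun a => by
      simp only [inv10, quadCovFive, quadCovThree, scaledCoef_sl2Act_weylElt,
        quarticCov_weylSix, transvectFour_weyl, transvectTwo_weyl, quadPair_weyl])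

theorem inv15_mem : inv15 (X : Fin 7 → MvPolynomial (Fin 7) ℂ) ∈ invariantRing 6 :=
  mem_invariantRing_of_natural map_inv15
    (fun b a => by
      simp only [inv15, quadCovSeven, quadCovFive, quadCovThree, scaledCoef_sl2Act_upperUnip,
        quarticCov_unipSix, transvectFour_unip, transvectTwo_unip, quadDet_unip])
    (fun a => by
      simp only [inv15, quadCovSeven, quadCovFive, quadCovThree, scaledCoef_sl2Act_weylElt,
        quarticCov_weylSix, transvectFour_weyl, transvectTwo_weyl, quadDet_weyl])

section Homogeneity

theorem isHomogeneous_numeral_mul {σ : Type*} (k : ℕ) [k.AtLeastTwo] {p : MvPolynomial σ ℂ}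
    {d : ℕ} (hp : p.IsHomogeneous d) :
    ((OfNat.ofNat k : MvPolynomial σ ℂ) * p).IsHomogeneous d := by
  have : (OfNat.ofNat k : MvPolynomial σ ℂ) = C (OfNat.ofNat k : ℂ) :=
    (map_ofNat C k).symm
  rw [this]
  simpa using (isHomogeneous_C σ (OfNat.ofNat k : ℂ)).mul hp

theorem isHomogeneous_numeral_mul_mul {σ : Type*} (k : ℕ) [k.AtLeastTwo]
    {p q : MvPolynomial σ ℂ} {d e : ℕ} (hp : p.IsHomogeneous d) (hq : q.IsHomogeneous e) :
    ((OfNat.ofNat k : MvPolynomial σ ℂ) * p * q).IsHomogeneous (d + e) := by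
  rw [mul_assoc]
  exact isHomogeneous_numeral_mul k (hp.mul hq)

variable {d e : ℕ}

theorem isHomogeneous_sq {σ : Type*} {p : MvPolynomial σ ℂ} (hp : p.IsHomogeneous d) :
    (p ^ 2).IsHomogeneous (d + d) := by
  rw [sq]
  exact hp.mul hp

theorem isHomogeneous_scaledCoef (k : Fin 7) :
    (scaledCoef (X : Fin 7 → MvPolynomial (Fin 7) ℂ) k).IsHomogeneous 1 := by
  fin_cases k <;> exact isHomogeneous_numeral_mul _ (isHomogeneous_X _ _)

theorem isHomogeneous_quarticCov {σ : Type*} {a : Fin 7 → MvPolynomial σ ℂ}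
    (ha : ∀ k, (a k).IsHomogeneous d) (k : Fin 5) : (quarticCov a k).IsHomogeneous (d + d) := by
  have h0 (i j : Fin 7) := (ha i).mul (ha j)
  have h1 (k : ℕ) [k.AtLeastTwo] (i j : Fin 7) :=
    isHomogeneous_numeral_mul_mul k (ha i) (ha j)
  have h2 (k : ℕ) [k.AtLeastTwo] (i : Fin 7) :=
    isHomogeneous_numeral_mul k (isHomogeneous_sq (ha i))
  fin_cases k
  · exact isHomogeneous_numeral_mul _ (((h0 _ _).sub (h1 _ _ _)).add (h2 _ _))
  · exact isHomogeneous_numeral_mul _ (((h0 _ _).sub (h1 _ _ _)).add (h1 _ _ _))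
  · exact ((h0 _ _).sub (h1 _ _ _)).add (h2 _ _)
  · exact isHomogeneous_numeral_mul _ (((h0 _ _).sub (h1 _ _ _)).add (h1 _ _ _))
  · exact isHomogeneous_numeral_mul _ (((h0 _ _).sub (h1 _ _ _)).add (h2 _ _))

theorem isHomogeneous_transvectFour {σ : Type*} {a : Fin 7 → MvPolynomial σ ℂ}
    {i : Fin 5 → MvPolynomial σ ℂ} (ha : ∀ k, (a k).IsHomogeneous d)
    (hi : ∀ k, (i k).IsHomogeneous e) (k : Fin 3) :
    (transvectFour a i k).IsHomogeneous (d + e) := by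
  have h0 (k : Fin 7) (j : Fin 5) := (ha k).mul (hi j)
  have h1 (n : ℕ) [n.AtLeastTwo] (k : Fin 7) (j : Fin 5) :=
    isHomogeneous_numeral_mul_mul n (ha k) (hi j)
  fin_cases k <;>
    exact ((((h0 _ _).sub (h1 _ _ _)).add (h1 _ _ _)).sub (h1 _ _ _)).add (h0 _ _)

theorem isHomogeneous_transvectTwo {σ : Type*} {i : Fin 5 → MvPolynomial σ ℂ}
    {q : Fin 3 → MvPolynomial σ ℂ} (hi : ∀ k, (i k).IsHomogeneous d)
    (hq : ∀ k, (q k).IsHomogeneous e) (k : Fin 3) :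
    (transvectTwo i q k).IsHomogeneous (d + e) := by
  have h0 (k : Fin 5) (j : Fin 3) := (hi k).mul (hq j)
  have h1 (n : ℕ) [n.AtLeastTwo] (k : Fin 5) (j : Fin 3) :=
    isHomogeneous_numeral_mul_mul n (hi k) (hq j)
  fin_cases k <;> exact ((h0 _ _).sub (h1 _ _ _)).add (h0 _ _)

theorem isHomogeneous_quadCovThree (k : Fin 3) :
    (quadCovThree (scaledCoef (X : Fin 7 → MvPolynomial (Fin 7) ℂ)) k).IsHomogeneous 3 :=
  isHomogeneous_transvectFour isHomogeneous_scaledCoef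
    (isHomogeneous_quarticCov isHomogeneous_scaledCoef) k

theorem isHomogeneous_quadCovFive (k : Fin 3) :
    (quadCovFive (scaledCoef (X : Fin 7 → MvPolynomial (Fin 7) ℂ)) k).IsHomogeneous 5 :=
  isHomogeneous_transvectTwo (isHomogeneous_quarticCov isHomogeneous_scaledCoef)
    isHomogeneous_quadCovThree k

theorem isHomogeneous_quadCovSeven (k : Fin 3) :
    (quadCovSeven (scaledCoef (X : Fin 7 → MvPolynomial (Fin 7) ℂ)) k).IsHomogeneous 7 :=
  isHomogeneous_transvectTwo (isHomogeneous_quarticCov isHomogeneous_scaledCoef)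
    isHomogeneous_quadCovFive k

theorem isHomogeneous_quadPair {σ : Type*} {p : Fin 3 → MvPolynomial σ ℂ}
    (hp : ∀ k, (p k).IsHomogeneous d) : (quadPair p p).IsHomogeneous (d + d) :=
  (((hp 0).mul (hp 2)).sub (isHomogeneous_numeral_mul_mul 2 (hp 1) (hp 1))).add
    ((hp 2).mul (hp 0))

theorem isHomogeneous_inv2 : (inv2 (X : Fin 7 → MvPolynomial (Fin 7) ℂ)).IsHomogeneous 2 := by
  have h := isHomogeneous_scaledCoef
  exact ((((h 0).mul (h 6)).sub (isHomogeneous_numeral_mul_mul 6 (h 1) (h 5))).add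
    (isHomogeneous_numeral_mul_mul 15 (h 2) (h 4))).sub
    (isHomogeneous_numeral_mul 10 (isHomogeneous_sq (h 3)))

theorem isHomogeneous_inv4 : (inv4 (X : Fin 7 → MvPolynomial (Fin 7) ℂ)).IsHomogeneous 4 := by
  have h := isHomogeneous_quarticCov isHomogeneous_scaledCoef
  exact (((h 0).mul (h 4)).sub (isHomogeneous_numeral_mul_mul 4 (h 1) (h 3))).add
    (isHomogeneous_numeral_mul 3 (isHomogeneous_sq (h 2)))

theorem isHomogeneous_inv6 : (inv6 (X : Fin 7 → MvPolynomial (Fin 7) ℂ)).IsHomogeneous 6 :=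
  isHomogeneous_quadPair isHomogeneous_quadCovThree

theorem isHomogeneous_inv10 : (inv10 (X : Fin 7 → MvPolynomial (Fin 7) ℂ)).IsHomogeneous 10 :=
  isHomogeneous_quadPair isHomogeneous_quadCovFive

theorem isHomogeneous_inv15 : (inv15 (X : Fin 7 → MvPolynomial (Fin 7) ℂ)).IsHomogeneous 15 := by
  have h3 := isHomogeneous_quadCovThree
  have h5 := isHomogeneous_quadCovFive
  have h7 := isHomogeneous_quadCovSeven
  have h (i j k l m) := (h3 i).mul (((h5 j).mul (h7 k)).sub ((h5 l).mul (h7 m)))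
  exact ((h _ _ _ _ _).sub (h _ _ _ _ _)).add (h _ _ _ _ _)

end Homogeneity
section Slice

variable {K : Type*} [Field K] [CharZero K]

/-- Coefficients of the sextic `t y x (x - y) (x - a y) (x - b y) (x - c y)`. -/
def sliceCoef (t a b c : K) : Fin 7 → K :=
  ![0, t, -(t * (1 + a + b + c)), t * (a + b + c + a * b + a * c + b * c),
    -(t * (a * b + a * c + b * c + a * b * c)), t * (a * b * c), 0]

/-- Joubert's six irrationalities (doubled) of the sextic with roots `∞, 0, 1, a, b, c`. -/
def joubert (t a b c : K) : Fin 6 → K :=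
  ![t * (b - a - c - a * b + a * c + b * c),
    t * (b - a + c + a * b - a * c - b * c),
    t * (a + b - c - a * b + a * c - b * c),
    t * (a - b - c + a * b - a * c + b * c),
    t * (a - b + c - a * b - a * c + b * c),
    t * (c - a - b + a * b + a * c - b * c)]

variable (t a b c : K)

/-- The quintic elementary symmetric function of Joubert's irrationalities. -/
def joubertFive : K :=
  32 * t ^ 5 * (a * b * c * (1 - a) * (1 - b) * (1 - c) * (a - b) * (a - c) * (b - c))

theorem prod_joubert (y : K) :
    (y - joubert t a b c 0) * (y - joubert t a b c 1) * (y - joubert t a b c 2)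
      * (y - joubert t a b c 3) * (y - joubert t a b c 4) * (y - joubert t a b c 5) =
    y ^ 6 + inv2 (sliceCoef t a b c) / 30 * y ^ 4
      + (inv2 (sliceCoef t a b c) ^ 2 / 1500 - inv4 (sliceCoef t a b c) / 6480)
        * y ^ 2 - joubertFive t a b c * y
      + (inv6 (sliceCoef t a b c) / 2332800
        + inv2 (sliceCoef t a b c) * inv4 (sliceCoef t a b c) / 2187000
        - inv2 (sliceCoef t a b c) ^ 3 / 675000) := by
  simp [joubert, joubertFive, sliceCoef, inv2, inv4, inv6, sexticPair, quarticPair, quadPair,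
      quadCovThree, transvectFour, quarticCov, scaledCoef]
  ring

theorem joubert_root (k : Fin 6) :
    joubert t a b c k ^ 6 + inv2 (sliceCoef t a b c) / 30 * joubert t a b c k ^ 4
      + (inv2 (sliceCoef t a b c) ^ 2 / 1500 - inv4 (sliceCoef t a b c) / 6480)
        * joubert t a b c k ^ 2 - joubertFive t a b c * joubert t a b c k
      + (inv6 (sliceCoef t a b c) / 2332800
        + inv2 (sliceCoef t a b c) * inv4 (sliceCoef t a b c) / 2187000
        - inv2 (sliceCoef t a b c) ^ 3 / 675000) = 0 := by
  rw [← prod_joubert]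
  fin_cases k <;> simp

theorem joubertFive_sq_eq_disc (p q r s u : K) (hp : p = t) (hq : q = -(t * (1 + a + b + c)))
    (hr : r = t * (a + b + c + a * b + a * c + b * c))
    (hs : s = -(t * (a * b + a * c + b * c + a * b * c))) (hu : u = t * (a * b * c)) :
    joubertFive t a b c ^ 2 = 1024 / 27 * p ^ 2 * u ^ 2 *
      (4 * (12 * p * u - 3 * q * s + r ^ 2) ^ 3 - (72 * p * r * u + 9 * q * r * s
        - 27 * p * s ^ 2 - 27 * u * q ^ 2 - 2 * r ^ 3) ^ 2) := by
  subst hp hq hr hs hu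
  rw [joubertFive]
  ring

theorem disc_slice (p q r s u : K) :
    1024 / 27 * p ^ 2 * u ^ 2 *
      (4 * (12 * p * u - 3 * q * s + r ^ 2) ^ 3 - (72 * p * r * u + 9 * q * r * s
        - 27 * p * s ^ 2 - 27 * u * q ^ 2 - 2 * r ^ 3) ^ 2) =
    1024 * (-inv10 ![0, p, q, r, s, u, 0] / 10749542400000
      - inv4 ![0, p, q, r, s, u, 0] * inv6 ![0, p, q, r, s, u, 0] / 8062156800000
      - inv2 ![0, p, q, r, s, u, 0] * inv4 ![0, p, q, r, s, u, 0] ^ 2 / 3023308800000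
      + inv2 ![0, p, q, r, s, u, 0] ^ 2 * inv6 ![0, p, q, r, s, u, 0] / 1679616000000
      + 13 * inv2 ![0, p, q, r, s, u, 0] ^ 3 * inv4 ![0, p, q, r, s, u, 0] / 6298560000000
      - inv2 ![0, p, q, r, s, u, 0] ^ 5 / 303750000000) := by
  simp [inv2, inv4, inv6, inv10, sexticPair, quarticPair, quadPair, quadCovFive, transvectTwo,
      quadCovThree, transvectFour, quarticCov, scaledCoef]
  ring

theorem quadPair_three_five_slice (p q r s u : K) :
    quadPair (quadCovThree (scaledCoef ![0, p, q, r, s, u, 0]))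
      (quadCovFive (scaledCoef ![0, p, q, r, s, u, 0])) =
    8 / 9 * inv4 ![0, p, q, r, s, u, 0] ^ 2
      + 2 * inv2 ![0, p, q, r, s, u, 0] * inv6 ![0, p, q, r, s, u, 0]
      - 8 / 3 * inv2 ![0, p, q, r, s, u, 0] ^ 2 * inv4 ![0, p, q, r, s, u, 0] := by
  simp [inv2, inv4, inv6, sexticPair, quarticPair, quadPair, quadCovFive, transvectTwo,
      quadCovThree, transvectFour, quarticCov, scaledCoef]
  ring

/-- The determinant of the endomorphism of quadratic forms attached to a quartic form. -/
def catalecticant (i : Fin 5 → K) : K :=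
  i 2 * (-2 * i 2 * i 2 + 2 * i 1 * i 3) + 2 * i 1 * (i 3 * i 2 - i 1 * i 4)
      + i 0 * (-2 * i 3 * i 3 + 2 * i 2 * i 4)

theorem catalecticant_slice (p q r s u : K) :
    catalecticant (quarticCov (scaledCoef ![0, p, q, r, s, u, 0])) =
    inv6 ![0, p, q, r, s, u, 0] / 2
      - 2 / 3 * inv2 ![0, p, q, r, s, u, 0] * inv4 ![0, p, q, r, s, u, 0] := by
  simp [catalecticant, inv2, inv4, inv6, sexticPair, quarticPair, quadPair,
      quadCovThree, transvectFour, quarticCov, scaledCoef]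
  ring

omit [CharZero K] in
theorem quadPair_transvectTwo (i : Fin 5 → K) (l m : Fin 3 → K) :
    quadPair (transvectTwo i l) m = quadPair l (transvectTwo i m) := by
  simp [quadPair, transvectTwo]
  ring

omit [CharZero K] in
theorem two_mul_quadDet_sq (l m n : Fin 3 → K) :
    2 * quadDet l m n ^ 2 =
      quadPair l l * (quadPair m m * quadPair n n - quadPair m n * quadPair m n)
      - quadPair l m * (quadPair l m * quadPair n n - quadPair m n * quadPair l n)
      + quadPair l n * (quadPair l m * quadPair m n - quadPair m m * quadPair l n) := by
  simp [quadPair, quadDet]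
  ring

omit [CharZero K] in
/-- The Cayley–Hamilton identity for the self-adjoint endomorphism `transvectTwo i`. -/
theorem transvectTwo_cayley (i : Fin 5 → K) (l : Fin 3 → K) (k : Fin 3) :
    transvectTwo i (transvectTwo i (transvectTwo i l)) k =
      quarticPair i * transvectTwo i l k + catalecticant i * l k := by
  fin_cases k <;> simp [transvectTwo, quarticPair, catalecticant] <;> ring

theorem joubertFive_sq :
    joubertFive t a b c ^ 2 =
      1024 * (-inv10 (sliceCoef t a b c) / 10749542400000
      - inv4 (sliceCoef t a b c) * inv6 (sliceCoef t a b c) / 8062156800000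
      - inv2 (sliceCoef t a b c) * inv4 (sliceCoef t a b c) ^ 2 / 3023308800000
      + inv2 (sliceCoef t a b c) ^ 2 * inv6 (sliceCoef t a b c) / 1679616000000
      + 13 * inv2 (sliceCoef t a b c) ^ 3 * inv4 (sliceCoef t a b c) / 6298560000000
      - inv2 (sliceCoef t a b c) ^ 5 / 303750000000) := by
  rw [joubertFive_sq_eq_disc t a b c _ _ _ _ _ rfl rfl rfl rfl rfl, disc_slice, sliceCoef]

/-- The square of the invariant of degree 15, through the Gram matrix of the three quadratic
covariants. -/
theorem two_mul_inv15_sq {A B G D R g₁ C g₃ g₄ : K} (hA : inv2 (sliceCoef t a b c) = A)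
    (hB : inv4 (sliceCoef t a b c) = B) (hG : inv6 (sliceCoef t a b c) = G)
    (hD : inv10 (sliceCoef t a b c) = D) (hR : inv15 (sliceCoef t a b c) = R)
    (h₁ : g₁ = 8 / 9 * B ^ 2 + 2 * A * G - 8 / 3 * A ^ 2 * B) (hC : C = G / 2 - 2 / 3 * A * B)
    (h₃ : g₃ = B * g₁ + C * G) (h₄ : g₄ = B * D + C * g₁) :
    2 * R ^ 2 = G * (D * g₄ - g₃ * g₃) - g₁ * (g₁ * g₄ - g₃ * D) + D * (g₁ * g₃ - D * D) := by
  have e₁ := quadPair_three_five_slice t (-(t * (1 + a + b + c)))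
    (t * (a + b + c + a * b + a * c + b * c)) (-(t * (a * b + a * c + b * c + a * b * c)))
    (t * (a * b * c))
  have eC := catalecticant_slice t (-(t * (1 + a + b + c)))
    (t * (a + b + c + a * b + a * c + b * c)) (-(t * (a * b + a * c + b * c + a * b * c)))
    (t * (a * b * c))
  rw [← sliceCoef, hA, hB, hG] at e₁ eC
  rw [← h₁] at e₁
  rw [← hC] at eC
  rw [inv4] at hB
  rw [inv6] at hG
  rw [inv10] at hD
  rw [inv15] at hR
  set α := scaledCoef (sliceCoef t a b c)
  have hfive : quadCovFive α = transvectTwo (quarticCov α) (quadCovThree α) := rfl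
  have hseven : quadCovSeven α = transvectTwo (quarticCov α) (quadCovFive α) := rfl
  have cay : transvectTwo (quarticCov α) (quadCovSeven α) =
      fun k => B * quadCovFive α k + C * quadCovThree α k := by
    funext k
    rw [hseven, hfive, transvectTwo_cayley, hB, eC]
  have lin (x y z : Fin 3 → K) : quadPair x (fun k => B * y k + C * z k) =
      B * quadPair x y + C * quadPair x z := by
    simp only [quadPair]
    ring
  have comm (x y : Fin 3 → K) : quadPair x y = quadPair y x := by
    simp only [quadPair]
    ring
  have e₂ : quadPair (quadCovThree α) (quadCovSeven α) = D := by
    rw [hseven, ← quadPair_transvectTwo, ← hfive, hD]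
  have e₃ : quadPair (quadCovFive α) (quadCovSeven α) = g₃ := by
    conv_lhs => rw [hfive]
    rw [quadPair_transvectTwo, cay, lin, e₁, hG, h₃]
  have e₄ : quadPair (quadCovSeven α) (quadCovSeven α) = g₄ := by
    conv_lhs => enter [1]; rw [hseven]
    rw [quadPair_transvectTwo, cay, lin, hD, comm, e₁, h₄]
  rw [← hR, two_mul_quadDet_sq, e₁, e₂, e₃, e₄, hG, hD]

end Slice
section Quintic

variable {R S : Type*} [CommRing R] [CommRing S]

/-- Coefficients of the sextic `t y ∏ (x - z_p y)`. -/
def quinCoef (t : R) (z : Fin 5 → R) : Fin 7 → R :=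
  ![0, t, -(t * (z 0 + z 1 + z 2 + z 3 + z 4)),
    t * (z 0 * z 1 + z 0 * z 2 + z 0 * z 3 + z 0 * z 4 + z 1 * z 2 + z 1 * z 3 + z 1 * z 4
      + z 2 * z 3 + z 2 * z 4 + z 3 * z 4),
    -(t * (z 0 * z 1 * z 2 + z 0 * z 1 * z 3 + z 0 * z 1 * z 4 + z 0 * z 2 * z 3 + z 0 * z 2 * z 4
      + z 0 * z 3 * z 4 + z 1 * z 2 * z 3 + z 1 * z 2 * z 4 + z 1 * z 3 * z 4 + z 2 * z 3 * z 4)),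
    t * (z 0 * z 1 * z 2 * z 3 + z 0 * z 1 * z 2 * z 4 + z 0 * z 1 * z 3 * z 4
      + z 0 * z 2 * z 3 * z 4 + z 1 * z 2 * z 3 * z 4),
    -(t * (z 0 * z 1 * z 2 * z 3 * z 4))]

theorem map_quinCoef (f : R →+* S) (t : R) (z : Fin 5 → R) :
    quinCoef (f t) (f ∘ z) = f ∘ quinCoef t z := by
  ext k
  fin_cases k <;> simp [quinCoef]

theorem quinCoef_swap (t : R) (z : Fin 5 → R) (m : Fin 5) :
    quinCoef t (z ∘ Equiv.swap 0 m) = quinCoef t z := by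
  ext k
  fin_cases m <;> fin_cases k <;> simp [quinCoef, Equiv.swap_apply_def] <;> ring

theorem sliceCoef_eq_quinCoef {K : Type*} [Field K] (t a b c : K) :
    sliceCoef t a b c = quinCoef t ![0, 1, a, b, c] := by
  ext k
  fin_cases k <;> simp [quinCoef, sliceCoef]

end Quintic

theorem formPoly_quinCoef (t : ℂ) (z : Fin 5 → ℂ) :
    formPoly 6 (quinCoef t z) = C t * X 1 * ∏ p, (X 0 - C (z p) * X 1) := by
  simp [formPoly, quinCoef, Fin.sum_univ_succ, Fin.prod_univ_succ]
  ring

/-- The substitution `x ↦ s x + (β / s) y`, `y ↦ y / s`. -/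
def affineElt (s β : ℂ) (hs : s ≠ 0) : Matrix.SpecialLinearGroup (Fin 2) ℂ :=
  ⟨!![s, β / s; 0, 1 / s], by simp [hs]⟩

theorem sl2Act_affineElt (t s β : ℂ) (hs : s ≠ 0) (w : Fin 5 → ℂ) :
    sl2Act 6 (affineElt s β hs) (quinCoef t fun p => s ^ 2 * w p + β) =
      quinCoef (t * s ^ 4) w := by
  rw [sl2Act_eq_iff, formPoly_quinCoef, formPoly_quinCoef]
  have h (p : Fin 5) : linSubst (affineElt s β hs) (X 0 - C (s ^ 2 * w p + β) * X 1) =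
      C s * (X 0 - C (w p) * X 1) := by
    have e : (C (β / s) : MvPolynomial (Fin 2) ℂ) = C β * C s⁻¹ := by
      rw [div_eq_mul_inv, C_mul]
    have e' : (C s * C s⁻¹ : MvPolynomial (Fin 2) ℂ) = 1 := by
      rw [← C_mul, mul_inv_cancel₀ hs, C_1]
    simp [linSubst, affineElt, e]
    linear_combination (-C s * C (w p) * X 1 : MvPolynomial (Fin 2) ℂ) * e'
  have h1 : linSubst (affineElt s β hs) (X 1) = C s⁻¹ * X 1 := by
    simp [linSubst, affineElt]
  have hC : linSubst (affineElt s β hs) (C t) = C t := by simp [linSubst]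
  rw [map_mul, map_mul, map_prod, Finset.prod_congr rfl fun p _ => h p, Finset.prod_mul_distrib,
    h1, hC]
  have e' : (C s * C s⁻¹ : MvPolynomial (Fin 2) ℂ) = 1 := by
    rw [← C_mul, mul_inv_cancel₀ hs, C_1]
  simp only [Finset.prod_const, Finset.card_univ, Fintype.card_fin, map_mul, map_pow]
  linear_combination (C t * C s ^ 4 * X 1 * ∏ p, (X 0 - C (w p) * X 1) :
    MvPolynomial (Fin 2) ℂ) * e'

theorem eval_quinCoef_affine {h : MvPolynomial (Fin 7) ℂ} (hh : h ∈ invariantRing 6)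
    (t β : ℂ) {δ : ℂ} (hδ : δ ≠ 0) (w : Fin 5 → ℂ) :
    eval (quinCoef t fun p => δ * w p + β) h = eval (quinCoef (t * δ ^ 2) w) h := by
  obtain ⟨s, rfl⟩ : ∃ s : ℂ, δ = s ^ 2 := ⟨_, (Complex.cpow_nat_inv_pow δ two_ne_zero).symm⟩
  have hs : s ≠ 0 := by rintro rfl; simp at hδ
  rw [← hh (affineElt s β hs), sl2Act_affineElt]
  ring_nf

theorem algHom_aeval_quinCoef {A B : Type*} [CommRing A] [CommRing B] [Algebra ℂ A] [Algebra ℂ B]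
    (f : A →ₐ[ℂ] B) (t : A) (z : Fin 5 → A) (h : MvPolynomial (Fin 7) ℂ) :
    f (aeval (quinCoef t z) h) = aeval (quinCoef (f t) fun p => f (z p)) h := by
  rw [← AlgHom.comp_apply, comp_aeval]
  congr 2
  exact (map_quinCoef f.toRingHom t z).symm

theorem aeval_quinCoef_affine {h : MvPolynomial (Fin 7) ℂ} (hh : h ∈ invariantRing 6)
    {K : Type*} [CommRing K] [Algebra ℂ K] (t δ β : K) (w : Fin 5 → K) :
    aeval (quinCoef t fun p => δ * w p + β) h = aeval (quinCoef (t * δ ^ 2) w) h := by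
  let T : MvPolynomial (Fin 3 ⊕ Fin 5) ℂ := X (Sum.inl 0)
  let Δ : MvPolynomial (Fin 3 ⊕ Fin 5) ℂ := X (Sum.inl 1)
  let Β : MvPolynomial (Fin 3 ⊕ Fin 5) ℂ := X (Sum.inl 2)
  let W : Fin 5 → MvPolynomial (Fin 3 ⊕ Fin 5) ℂ := fun p => X (Sum.inr p)
  have hzero : Δ * (aeval (quinCoef T fun p => Δ * W p + Β) h -
      aeval (quinCoef (T * Δ ^ 2) W) h) = 0 := by
    apply MvPolynomial.funext
    intro v
    by_cases hv : v (Sum.inl 1) = 0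
    · simp [Δ, hv]
    · have h1 := algHom_aeval_quinCoef (aeval v) T (fun p => Δ * W p + Β) h
      have h2 := algHom_aeval_quinCoef (aeval v) (T * Δ ^ 2) W h
      have h3 := eval_quinCoef_affine hh (v (Sum.inl 0)) (v (Sum.inl 2)) hv fun p => v (Sum.inr p)
      simp only [aeval_eq_eval, T, Δ, Β, W, map_add, map_mul, map_pow, eval_X] at h1 h2
      simp only [T, Δ, Β, W, map_mul, map_sub, eval_X, map_zero]
      rw [h1, h2, h3, sub_self, mul_zero]
  have hne : Δ ≠ 0 := X_ne_zero _
  have heq := sub_eq_zero.1 ((mul_eq_zero.1 hzero).resolve_left hne)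
  have := congrArg (aeval (Sum.elim ![t, δ, β] w)) heq
  rw [algHom_aeval_quinCoef, algHom_aeval_quinCoef] at this
  simpa [T, Δ, Β, W] using this
set_option synthInstance.maxSize 1000 in
/-- Among five points of an ultrametric space one can remove one point so that the remaining
ones are well centred, provided all matchings are bounded. -/
theorem exists_center {Γ : Type*} [LinearOrderedCommGroupWithZero Γ] (d : Fin 5 → Fin 5 → Γ)
    (hsymm : ∀ i j, d i j = d j i) (hultra : ∀ i j k, d i k ≤ max (d i j) (d j k)) (τ : Γ)
    (h : ∀ i j k l, i ≠ j → i ≠ k → i ≠ l → j ≠ k → j ≠ l → k ≠ l → τ * d i j * d k l ≤ 1) :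
    ∃ i j m, i ≠ j ∧ i ≠ m ∧ j ≠ m ∧ (∀ p, p ≠ m → p ≠ i → d p i ≤ d i j) ∧
      τ * d i j * d i j ≤ 1 ∧ τ * d i j * d m i ≤ 1 := by
  have hmax (m : Fin 5) : ∃ ij : Fin 5 × Fin 5, (ij.1 ≠ ij.2 ∧ ij.1 ≠ m ∧ ij.2 ≠ m) ∧
      ∀ p q, p ≠ q → p ≠ m → q ≠ m → d p q ≤ d ij.1 ij.2 := by
    have hne : (Finset.univ.filter fun ij : Fin 5 × Fin 5 =>
        ij.1 ≠ ij.2 ∧ ij.1 ≠ m ∧ ij.2 ≠ m).Nonempty := by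
      revert m
      decide
    obtain ⟨ij, hij, hle⟩ := Finset.exists_max_image _ (fun ij => d ij.1 ij.2) hne
    refine ⟨ij, (Finset.mem_filter.1 hij).2, fun p q h1 h2 h3 => hle (p, q) ?_⟩
    simp [h1, h2, h3]
  choose f hf hfmax using hmax
  obtain ⟨m, -, hm⟩ := Finset.exists_min_image Finset.univ (fun m => d (f m).1 (f m).2)
    Finset.univ_nonempty
  obtain ⟨hij, him, hjm⟩ := hf m
  have hle := hfmax m
  generalize hi : (f m).1 = i at *
  generalize hj : (f m).2 = j at *
  have hothers : ∀ m i j : Fin 5, i ≠ j → i ≠ m → j ≠ m → ∃ k l,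
      (k ≠ l ∧ k ≠ i ∧ k ≠ j ∧ k ≠ m) ∧ (l ≠ i ∧ l ≠ j ∧ l ≠ m) ∧
      ∀ p, p ∈ [i, j, k, l, m] := by decide
  obtain ⟨k, l, ⟨hkl, hki, hkj, hkm⟩, ⟨hli, hlj, hlm⟩, hall⟩ := hothers m i j hij him hjm
  simp only [List.mem_cons, List.not_mem_nil, or_false] at hall
  refine ⟨i, j, m, hij, him, hjm, fun p hp hpi => hle p i hpi hp him, ?_⟩
  have mono {x y : Γ} (hxy : x ≤ y) (z : Γ) : z * x ≤ z * y := mul_le_mul_right hxy z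
  have far (k : Fin 5) (hki : k ≠ i) (hkj : k ≠ j) (hkm : k ≠ m) (hk : d i j ≤ d m k) :
      τ * d i j * d i j ≤ 1 ∧ τ * d i j * d m i ≤ 1 := by
    have h1 : τ * d i j * d m k ≤ 1 := h i j m k hij him hki.symm hjm hkj.symm hkm.symm
    refine ⟨(mono hk _).trans h1, (mono ?_ _).trans h1⟩
    exact (hultra m k i).trans (max_le le_rfl ((hle k i hki hkm him).trans hk))
  by_cases hk : d i j ≤ d m k
  · exact far k hki hkj hkm hk
  by_cases hl : d i j ≤ d m l
  · exact far l hli hlj hlm hl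
  push Not at hk hl
  have hdkl : d k l < d i j :=
    (hultra k m l).trans_lt (max_lt (by rwa [hsymm]) hl)
  have key (i' j' k' l' : Fin 5)
      (hall : ∀ p, p = i' ∨ p = j' ∨ p = k' ∨ p = l' ∨ p = m)
      (hk' : d m k' < d i j) (hl' : d m l' < d i j) (hkl' : d k' l' < d i j) :
      d i j ≤ d j' l' := by
    by_contra! hlt
    obtain ⟨h1, h2, h3⟩ := hf i'
    have hm' := hm i' (Finset.mem_univ _)
    have aux (p : Fin 5) (hp : p ≠ i') : p = l' ∨ d p l' < d i j := by
      rcases hall p with rfl | rfl | rfl | rfl | rfl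
      · exact absurd rfl hp
      · exact .inr hlt
      · exact .inr hkl'
      · exact .inl rfl
      · exact .inr hl'
    have hcontra : d (f i').1 (f i').2 < d i j := by
      rcases aux _ h2 with e1 | e1 <;> rcases aux _ h3 with e2 | e2
      · exact absurd (e1.trans e2.symm) h1
      · rw [e1, hsymm]; exact e2
      · rw [e2]; exact e1
      · exact (hultra _ l' _).trans_lt (max_lt e1 (by rwa [hsymm]))
    exact absurd hm' (not_le.2 hcontra)
  have hjl := key i j k l hall hk hl hdkl
  have hik := key j i l k (fun p => by have := hall p; tauto) hl hk (by rwa [hsymm])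
  constructor
  · have h1 := h i k j l hki.symm hij hli.symm hkj hkl hlj.symm
    exact (mul_le_mul' (mono hik _) hjl).trans h1
  · have hmi : d m i ≤ d i j := (hultra m k i).trans (max_le hk.le (hle k i hki hkm him))
    have h1 := h i k j l hki.symm hij hli.symm hkj hkl hlj.symm
    exact (mono hmi _).trans ((mul_le_mul' (mono hik _) hjl).trans h1)

theorem ValuationSubring.mem_of_monic {K : Type*} [Field K] (O : ValuationSubring K) {n : ℕ}
    {x : K} (c : Fin n → K) (hc : ∀ i, c i ∈ O) (h : x ^ n = ∑ i, c i * x ^ (i : ℕ)) : x ∈ O := by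
  rcases O.mem_or_inv_mem x with hx | hx
  · exact hx
  by_cases h0 : x = 0
  · rw [h0]; exact O.zero_mem
  rcases n with _ | n
  · simp at h
  have : x = ∑ i : Fin (n + 1), c i * x⁻¹ ^ (n - (i : ℕ)) := by
    have e : x = x ^ (n + 1) * x⁻¹ ^ n := by
      rw [pow_succ', mul_assoc, ← mul_pow, mul_inv_cancel₀ h0, one_pow, mul_one]
    conv_lhs => rw [e, h, Finset.sum_mul]
    refine Finset.sum_congr rfl fun i _ => ?_
    rw [mul_assoc, inv_pow, inv_pow, pow_sub₀ x h0 (Nat.lt_succ_iff.1 i.2), mul_inv, inv_inv,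
      mul_comm (x ^ (i : ℕ))]
  rw [this]
  exact sum_mem fun i _ => O.mul_mem _ _ (hc i) (pow_mem hx _)
section Valuation

variable {K : Type*} [Field K] [Algebra ℂ K] {O : ValuationSubring K}

theorem ValuationSubring.div_ofNat_mem (hC : ∀ z : ℂ, algebraMap ℂ K z ∈ O) {x : K} (hx : x ∈ O)
    (n : ℕ) [n.AtLeastTwo] : x / OfNat.ofNat n ∈ O := by
  have h : algebraMap ℂ K (OfNat.ofNat n)⁻¹ = (OfNat.ofNat n : K)⁻¹ := by
    rw [map_inv₀, map_ofNat]
  rw [div_eq_mul_inv, ← h]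
  exact O.mul_mem _ _ hx (hC _)

variable (hC : ∀ z : ℂ, algebraMap ℂ K z ∈ O) {t a b c : K}
  (hA : inv2 (sliceCoef t a b c) ∈ O) (hB : inv4 (sliceCoef t a b c) ∈ O)
  (hG : inv6 (sliceCoef t a b c) ∈ O) (hD : inv10 (sliceCoef t a b c) ∈ O)

include hC hA hB hG hD

theorem joubert_mem (k : Fin 6) : joubert t a b c k ∈ O := by
  have : CharZero K := charZero_of_injective_algebraMap (algebraMap ℂ K).injective
  have hdiv {x : K} (hx : x ∈ O) (n : ℕ) [n.AtLeastTwo] : x / OfNat.ofNat n ∈ O :=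
    O.div_ofNat_mem hC hx n
  have hnum (n : ℕ) [n.AtLeastTwo] : (OfNat.ofNat n : K) ∈ O := ofNat_mem O n
  have h5 : joubertFive t a b c ∈ O := by
    refine O.mem_of_monic (n := 2) ![joubertFive t a b c ^ 2, 0] ?_ (by simp)
    rw [joubertFive_sq]
    have h : 1024 * (-inv10 (sliceCoef t a b c) / 10749542400000
      - inv4 (sliceCoef t a b c) * inv6 (sliceCoef t a b c) / 8062156800000
      - inv2 (sliceCoef t a b c) * inv4 (sliceCoef t a b c) ^ 2 / 3023308800000
      + inv2 (sliceCoef t a b c) ^ 2 * inv6 (sliceCoef t a b c) / 1679616000000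
      + 13 * inv2 (sliceCoef t a b c) ^ 3 * inv4 (sliceCoef t a b c) / 6298560000000
      - inv2 (sliceCoef t a b c) ^ 5 / 303750000000) ∈ O := by
      repeat' first
        | assumption | exact hnum _ | apply hdiv | apply neg_mem | apply pow_mem | apply mul_mem
        | apply add_mem | apply sub_mem
    intro i
    fin_cases i
    · exact h
    · exact O.zero_mem
  have root := joubert_root t a b c k
  set E₆ := inv6 (sliceCoef t a b c) / 2332800
        + inv2 (sliceCoef t a b c) * inv4 (sliceCoef t a b c) / 2187000
        - inv2 (sliceCoef t a b c) ^ 3 / 675000 with hE₆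
  set E₄ := inv2 (sliceCoef t a b c) ^ 2 / 1500 - inv4 (sliceCoef t a b c) / 6480 with hE₄
  set E₂ := inv2 (sliceCoef t a b c) / 30 with hE₂
  have m₆ : E₆ ∈ O := by
    rw [hE₆]
    repeat' first
      | assumption | apply hdiv | apply pow_mem | apply mul_mem | apply add_mem | apply sub_mem
  have m₄ : E₄ ∈ O := by
    rw [hE₄]
    repeat' first | assumption | apply hdiv | apply pow_mem | apply sub_mem
  have m₂ : E₂ ∈ O := hdiv hA _
  refine O.mem_of_monic (n := 6) ![-E₆, joubertFive t a b c, -E₄, 0, -E₂, 0] ?_ ?_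
  · intro i
    fin_cases i
    exacts [neg_mem m₆, h5, neg_mem m₄, O.zero_mem, neg_mem m₂, O.zero_mem]
  · simp [Fin.sum_univ_succ]
    linear_combination root

theorem matching_mem {i j k l : Fin 5} (hij : i ≠ j) (hik : i ≠ k) (hil : i ≠ l) (hjk : j ≠ k)
    (hjl : j ≠ l) (hkl : k ≠ l) :
    t * ((![0, 1, a, b, c] : Fin 5 → K) i - (![0, 1, a, b, c] : Fin 5 → K) j) *
      ((![0, 1, a, b, c] : Fin 5 → K) k - (![0, 1, a, b, c] : Fin 5 → K) l) ∈ O := by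
  have : CharZero K := charZero_of_injective_algebraMap (algebraMap ℂ K).injective
  have hy := joubert_mem hC hA hB hG hD
  have hsum (p q : Fin 6) : (joubert t a b c p + joubert t a b c q) / 2 ∈ O :=
    O.div_ofNat_mem hC (add_mem (hy p) (hy q)) 2
  have hneg (p q : Fin 6) : -((joubert t a b c p + joubert t a b c q) / 2) ∈ O :=
    neg_mem (hsum p q)
  generalize hz : (![0, 1, a, b, c] : Fin 5 → K) = z
  have key : ∀ i j k l : Fin 5, i < j → k < l → i < k → j ≠ k → j ≠ l →
      t * (z i - z j) * (z k - z l) ∈ O := by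
    have wit (i j k l : Fin 5) (p q : Fin 6) (h : t * (z i - z j) * (z k - z l) =
        (joubert t a b c p + joubert t a b c q) / 2 ∨ t * (z i - z j) * (z k - z l) =
        -((joubert t a b c p + joubert t a b c q) / 2)) : t * (z i - z j) * (z k - z l) ∈ O := by
      rcases h with h | h
      · rw [h]; exact hsum p q
      · rw [h]; exact hneg p q
    have he : z 0 = 0 ∧ z 1 = 1 ∧ z 2 = a ∧ z 3 = b ∧ z 4 = c := by
      rw [← hz]
      exact ⟨rfl, rfl, rfl, rfl, rfl⟩
    have w1 := wit 0 1 2 3 0 1 (.inl (by simp [he, joubert]; ring))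
    have w2 := wit 1 2 3 4 0 2 (.inl (by simp [he, joubert]; ring))
    have w3 := wit 0 4 1 3 0 3 (.inl (by simp [he, joubert]; ring))
    have w4 := wit 0 3 2 4 0 4 (.inl (by simp [he, joubert]; ring))
    have w5 := wit 0 2 1 4 0 5 (.inl (by simp [he, joubert]; ring))
    have w6 := wit 0 3 1 4 1 2 (.inr (by simp [he, joubert]; ring))
    have w7 := wit 0 2 3 4 1 3 (.inr (by simp [he, joubert]; ring))
    have w8 := wit 0 4 1 2 1 4 (.inr (by simp [he, joubert]; ring))
    have w9 := wit 1 3 2 4 1 5 (.inr (by simp [he, joubert]; ring))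
    have w10 := wit 0 1 2 4 2 3 (.inr (by simp [he, joubert]; ring))
    have w11 := wit 0 2 1 3 2 4 (.inr (by simp [he, joubert]; ring))
    have w12 := wit 0 4 2 3 2 5 (.inr (by simp [he, joubert]; ring))
    have w13 := wit 1 4 2 3 3 4 (.inl (by simp [he, joubert]; ring))
    have w14 := wit 0 3 1 2 3 5 (.inl (by simp [he, joubert]; ring))
    have w15 := wit 0 1 3 4 4 5 (.inl (by simp [he, joubert]; ring))
    have hlist : ∀ i j k l : Fin 5, i < j → k < l → i < k → j ≠ k → j ≠ l → (i, j, k, l) ∈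
        [(0, 1, 2, 3), (1, 2, 3, 4), (0, 4, 1, 3), (0, 3, 2, 4), (0, 2, 1, 4),
          (0, 3, 1, 4), (0, 2, 3, 4), (0, 4, 1, 2), (1, 3, 2, 4), (0, 1, 2, 4),
          (0, 2, 1, 3), (0, 4, 2, 3), (1, 4, 2, 3), (0, 3, 1, 2), (0, 1, 3, 4)] := by
      decide
    intro i j k l h1 h2 h3 h4 h5
    have := hlist i j k l h1 h2 h3 h4 h5
    simp only [List.mem_cons, Prod.mk.injEq, List.not_mem_nil, or_false] at this
    clear hlist wit hsum hneg hy h1 h2 h3 h4 h5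
    rcases this with h | h | h | h | h | h | h | h | h | h | h | h | h | h | h <;>
      (obtain ⟨rfl, rfl, rfl, rfl⟩ := h; assumption)
  have key2 : ∀ i j k l : Fin 5, i < j → k < l → i ≠ k → i ≠ l → j ≠ k → j ≠ l →
      t * (z i - z j) * (z k - z l) ∈ O := by
    intro i j k l h1 h2 h3 h3' h4 h5
    rcases lt_or_gt_of_ne h3 with h | h
    · exact key i j k l h1 h2 h h4 h5
    · have := key k l i j h2 h1 h h3'.symm h5.symm
      rw [mul_right_comm] at this
      exact this
  rcases lt_or_gt_of_ne hij with h1 | h1 <;> rcases lt_or_gt_of_ne hkl with h2 | h2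
  · exact key2 i j k l h1 h2 hik hil hjk hjl
  · convert neg_mem (key2 i j l k h1 h2 hil hik hjl hjk) using 1; ring
  · convert neg_mem (key2 j i k l h1 h2 hjk hjl hik hil) using 1; ring
  · convert key2 j i l k h1 h2 hjl hjk hil hik using 1; ring

theorem aeval_sliceCoef_mem (hinj : Function.Injective (![0, 1, a, b, c] : Fin 5 → K))
    {h : MvPolynomial (Fin 7) ℂ} (hh : h ∈ invariantRing 6) :
    aeval (sliceCoef t a b c) h ∈ O := by
  have hmatch := @matching_mem K _ _ O hC t a b c hA hB hG hD
  rw [sliceCoef_eq_quinCoef]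
  generalize (![0, 1, a, b, c] : Fin 5 → K) = z at *
  have hv (x : K) : x ∈ O ↔ O.valuation x ≤ 1 := (O.valuation_le_one_iff x).symm
  obtain ⟨i, j, m, hij, him, hjm, h1, h2, h3⟩ := exists_center
    (fun i j => O.valuation (z i - z j)) (fun i j => Valuation.map_sub_swap _ _ _)
    (fun i j k => by
      have := O.valuation.map_add (z i - z j) (z j - z k)
      rwa [sub_add_sub_cancel] at this) (O.valuation t)
    (fun i j k l e1 e2 e3 e4 e5 e6 => by
      have := (hv _).1 (hmatch e1 e2 e3 e4 e5 e6)
      simpa only [map_mul] using this)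
  set δ := z i - z j with hδ
  have hδ0 : δ ≠ 0 := sub_ne_zero.2 (hinj.ne hij)
  have hvδ : O.valuation δ ≠ 0 := (Valuation.ne_zero_iff _).2 hδ0
  set w : Fin 5 → K := fun p => (z p - z i) / δ with hw
  have hz : z = fun p => δ * w p + z i := by
    funext p
    rw [hw]
    field_simp
    ring
  have hwmem (p : Fin 5) (hp : p ≠ m) : w p ∈ O := by
    by_cases hpi : p = i
    · simp [hw, hpi, O.zero_mem]
    · rw [hv, hw, map_div₀]
      exact div_le_one_of_le₀ (h1 p hp hpi) zero_le
  have hT : t * δ ^ 2 ∈ O := by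
    rw [hv, map_mul, map_pow, sq, ← mul_assoc]
    exact h2
  have hTw : t * δ ^ 2 * w m ∈ O := by
    have : t * δ ^ 2 * w m = t * δ * (z m - z i) := by
      rw [hw]
      field_simp
    rw [this, hv, map_mul, map_mul]
    exact h3
  have hcoef (k : Fin 7) : quinCoef (t * δ ^ 2) w k ∈ O := by
    rw [← quinCoef_swap _ _ m]
    have g0 : t * δ ^ 2 * (w ∘ Equiv.swap 0 m) 0 ∈ O := by simpa using hTw
    have g (p : Fin 5) (hp : p ≠ 0) : (w ∘ Equiv.swap 0 m) p ∈ O :=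
      hwmem _ fun e => hp (by
        rw [Equiv.swap_apply_eq_iff, Equiv.swap_apply_right] at e
        exact e)
    have g1 := g 1 (by decide)
    have g2 := g 2 (by decide)
    have g3 := g 3 (by decide)
    have g4 := g 4 (by decide)
    generalize w ∘ Equiv.swap 0 m = u at *
    generalize t * δ ^ 2 = T at *
    clear g
    fin_cases k
    · exact O.zero_mem
    · exact hT
    · have : T * u 0 + T * (u 1 + u 2 + u 3 + u 4) ∈ O := by
        repeat' first | assumption | apply add_mem | apply mul_mem
      convert neg_mem this using 1
      simp [quinCoef]
      ring
    · have : T * u 0 * (u 1 + u 2 + u 3 + u 4) + T * (u 1 * u 2 + u 1 * u 3 + u 1 * u 4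
          + u 2 * u 3 + u 2 * u 4 + u 3 * u 4) ∈ O := by
        repeat' first | assumption | apply add_mem | apply mul_mem
      convert this using 1
      simp [quinCoef]
      ring
    · have : T * u 0 * (u 1 * u 2 + u 1 * u 3 + u 1 * u 4 + u 2 * u 3 + u 2 * u 4 + u 3 * u 4)
          + T * (u 1 * u 2 * u 3 + u 1 * u 2 * u 4 + u 1 * u 3 * u 4 + u 2 * u 3 * u 4) ∈ O := by
        repeat' first | assumption | apply add_mem | apply mul_mem
      convert neg_mem this using 1
      simp [quinCoef]
      ring
    · have : T * u 0 * (u 1 * u 2 * u 3 + u 1 * u 2 * u 4 + u 1 * u 3 * u 4 + u 2 * u 3 * u 4)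
          + T * (u 1 * u 2 * u 3 * u 4) ∈ O := by
        repeat' first | assumption | apply add_mem | apply mul_mem
      convert this using 1
      simp [quinCoef]
      ring
    · have : T * u 0 * (u 1 * u 2 * u 3 * u 4) ∈ O := by
        repeat' first | assumption | apply mul_mem
      convert neg_mem this using 1
      simp [quinCoef]
      ring
  rw [hz, aeval_quinCoef_affine hh]
  have : aeval (quinCoef (t * δ ^ 2) w) h ∈ O.toSubring := by
    rw [aeval_def, eval₂_eq]
    refine sum_mem fun d _ => mul_mem (hC _) (prod_mem fun k _ => pow_mem (hcoef k) _)
  exact this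

end Valuation
section ReplaceGenerator

variable {K : Type*} [Field K] [Algebra ℂ K] {O : ValuationSubring K}
  (hC : ∀ z : ℂ, algebraMap ℂ K z ∈ O) {t a b c : K}
  (hA : inv2 (sliceCoef t a b c) ∈ O) (hB : inv4 (sliceCoef t a b c) ∈ O)
  (hR : inv15 (sliceCoef t a b c) ∈ O)

include hC hA hB hR

theorem inv10_mem_of_inv15_mem (hG : inv6 (sliceCoef t a b c) ∈ O) :
    inv10 (sliceCoef t a b c) ∈ O := by
  have : CharZero K := charZero_of_injective_algebraMap (algebraMap ℂ K).injective
  have hdiv {x : K} (hx : x ∈ O) (n : ℕ) [n.AtLeastTwo] : x / OfNat.ofNat n ∈ O :=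
    O.div_ofNat_mem hC hx n
  have hnum (n : ℕ) [n.AtLeastTwo] : (OfNat.ofNat n : K) ∈ O := ofNat_mem O n
  have key := two_mul_inv15_sq t a b c rfl rfl rfl rfl rfl rfl rfl rfl rfl
  generalize inv2 (sliceCoef t a b c) = A at *
  generalize inv4 (sliceCoef t a b c) = B at *
  generalize inv6 (sliceCoef t a b c) = G at *
  generalize inv10 (sliceCoef t a b c) = D at *
  generalize inv15 (sliceCoef t a b c) = R at *
  have hg : 8 / 9 * B ^ 2 + 2 * A * G - 8 / 3 * A ^ 2 * B ∈ O := by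
    repeat' first
      | assumption | exact hnum _ | apply hdiv | apply pow_mem | apply mul_mem
      | apply add_mem | apply sub_mem
  have hc : G / 2 - 2 / 3 * A * B ∈ O := by
    repeat' first
      | assumption | exact hnum _ | apply hdiv | apply mul_mem | apply sub_mem
  generalize 8 / 9 * B ^ 2 + 2 * A * G - 8 / 3 * A ^ 2 * B = g at *
  generalize G / 2 - 2 / 3 * A * B = E at *
  have h0 : -(2 * R ^ 2) - G * (B * g + E * G) * (B * g + E * G) - E * g ^ 3 ∈ O := by
    repeat' first
      | assumption | exact hnum _ | apply neg_mem | apply pow_mem | apply mul_mem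
      | apply add_mem | apply sub_mem
  have h1 : G * E * g - B * g ^ 2 + 2 * g * (B * g + E * G) ∈ O := by
    repeat' first
      | assumption | exact hnum _ | apply pow_mem | apply mul_mem | apply add_mem | apply sub_mem
  refine O.mem_of_monic (n := 3)
    ![-(2 * R ^ 2) - G * (B * g + E * G) * (B * g + E * G) - E * g ^ 3,
      G * E * g - B * g ^ 2 + 2 * g * (B * g + E * G), G * B] ?_ ?_
  · intro i
    fin_cases i
    exacts [h0, h1, mul_mem hG hB]
  · simp [Fin.sum_univ_succ]
    linear_combination key

theorem inv6_mem_of_inv15_mem (hD : inv10 (sliceCoef t a b c) ∈ O) :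
    inv6 (sliceCoef t a b c) ∈ O := by
  have : CharZero K := charZero_of_injective_algebraMap (algebraMap ℂ K).injective
  have hdiv {x : K} (hx : x ∈ O) (n : ℕ) [n.AtLeastTwo] : x / OfNat.ofNat n ∈ O :=
    O.div_ofNat_mem hC hx n
  have hnum (n : ℕ) [n.AtLeastTwo] : (OfNat.ofNat n : K) ∈ O := ofNat_mem O n
  have key := two_mul_inv15_sq t a b c rfl rfl rfl rfl rfl rfl rfl rfl rfl
  generalize inv2 (sliceCoef t a b c) = A at *
  generalize inv4 (sliceCoef t a b c) = B at *
  generalize inv6 (sliceCoef t a b c) = G at *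
  generalize inv10 (sliceCoef t a b c) = D at *
  generalize inv15 (sliceCoef t a b c) = R at *
  have hα : 8 / 9 * B ^ 2 - 8 / 3 * A ^ 2 * B ∈ O := by
    repeat' first
      | assumption | exact hnum _ | apply hdiv | apply pow_mem | apply mul_mem | apply sub_mem
  have hγ : -(2 / 3 * A * B) ∈ O := by
    repeat' first | assumption | exact hnum _ | apply hdiv | apply neg_mem | apply mul_mem
  obtain ⟨α, eα⟩ : ∃ α, α = 8 / 9 * B ^ 2 - 8 / 3 * A ^ 2 * B := ⟨_, rfl⟩
  obtain ⟨γ, eγ⟩ : ∃ γ, γ = -(2 / 3 * A * B) := ⟨_, rfl⟩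
  have e1 : 8 / 9 * B ^ 2 + 2 * A * G - 8 / 3 * A ^ 2 * B = α + 2 * A * G := by rw [eα]; ring
  have e2 : G / 2 - 2 / 3 * A * B = γ + G / 2 := by rw [eγ]; ring
  rw [e1, e2] at key
  rw [← eα] at hα
  rw [← eγ] at hγ
  clear e1 e2 eα eγ
  obtain ⟨κ, eκ⟩ : ∃ κ, κ = 2 * A * B + γ := ⟨_, rfl⟩
  have hκ : κ ∈ O := by
    rw [eκ]
    repeat' first | assumption | exact hnum _ | apply add_mem | apply mul_mem
  let k₀ := -(2 * R ^ 2) - D ^ 3 - B * D * α ^ 2 + 2 * D * α * (B * α) - γ * α ^ 3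
  let k₁ := B * D ^ 2 + D * γ * α - 4 * A * B * D * α + 2 * D * (α * κ + 2 * A * (B * α))
    - (B * α) ^ 2 - (α ^ 3 / 2 + 6 * α ^ 2 * A * γ)
  let k₂ := D * (α / 2 + 2 * A * γ) - 4 * A ^ 2 * B * D + 2 * D * (α / 2 + 2 * A * κ)
    - 2 * (B * α) * κ - (3 * α ^ 2 * A + 12 * α * A ^ 2 * γ)
  let k₃ := D * A + 2 * D * A - (κ ^ 2 + B * α) - (6 * α * A ^ 2 + 8 * A ^ 3 * γ)
  let k₄ := -κ - 4 * A ^ 3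
  have h₀ : 4 * k₀ ∈ O := by
    repeat' first
      | assumption | exact hnum _ | apply hdiv | apply neg_mem | apply pow_mem | apply mul_mem
      | apply add_mem | apply sub_mem
  have h₁ : 4 * k₁ ∈ O := by
    repeat' first
      | assumption | exact hnum _ | apply hdiv | apply neg_mem | apply pow_mem | apply mul_mem
      | apply add_mem | apply sub_mem
  have h₂ : 4 * k₂ ∈ O := by
    repeat' first
      | assumption | exact hnum _ | apply hdiv | apply neg_mem | apply pow_mem | apply mul_mem
      | apply add_mem | apply sub_mem
  have h₃ : 4 * k₃ ∈ O := by
    repeat' first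
      | assumption | exact hnum _ | apply hdiv | apply neg_mem | apply pow_mem | apply mul_mem
      | apply add_mem | apply sub_mem
  have h₄ : 4 * k₄ ∈ O := by
    repeat' first
      | assumption | exact hnum _ | apply hdiv | apply neg_mem | apply pow_mem | apply mul_mem
      | apply add_mem | apply sub_mem
  refine O.mem_of_monic (n := 5) ![4 * k₀, 4 * k₁, 4 * k₂, 4 * k₃, 4 * k₄] ?_ ?_
  · intro i
    fin_cases i
    exacts [h₀, h₁, h₂, h₃, h₄]
  · simp [Fin.sum_univ_succ, k₀, k₁, k₂, k₃, k₄]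
    rw [eκ]
    linear_combination 4 * key

end ReplaceGenerator
section Injectivity

variable {h : MvPolynomial (Fin 7) ℂ}

theorem eval_quinCoef_eq_zero (hh : h ∈ invariantRing 6)
    (h0 : ∀ t a b c : ℂ, eval (quinCoef t ![0, 1, a, b, c]) h = 0) (t : ℂ) (z : Fin 5 → ℂ) :
    eval (quinCoef t z) h = 0 := by
  have h1 (t : ℂ) (z : Fin 5 → ℂ) (hz : z 1 - z 0 ≠ 0) : eval (quinCoef t z) h = 0 := by
    have hw : z = fun p => (z 1 - z 0) * ((z p - z 0) / (z 1 - z 0)) + z 0 := by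
      funext p
      field_simp
      ring
    have hw' : (fun p => (z p - z 0) / (z 1 - z 0)) =
        ![0, 1, (z 2 - z 0) / (z 1 - z 0), (z 3 - z 0) / (z 1 - z 0),
          (z 4 - z 0) / (z 1 - z 0)] := by
      funext p
      fin_cases p <;> simp [hz]
    rw [hw, eval_quinCoef_affine hh t (z 0) hz fun p => (z p - z 0) / (z 1 - z 0), hw', h0]
  let Z : Fin 5 → MvPolynomial (Option (Fin 5)) ℂ := fun p => X (some p)
  have hne : Z 1 - Z 0 ≠ 0 := by
    rw [sub_ne_zero]
    exact fun e => by simpa using X_injective e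
  have hP : aeval (quinCoef (X none) Z) h * (Z 1 - Z 0) = 0 := by
    apply MvPolynomial.funext
    intro v
    by_cases hv : v (some 1) - v (some 0) = 0
    · simp [Z, hv]
    · have := algHom_aeval_quinCoef (aeval v) (X none) Z h
      simp only [aeval_eq_eval, Z, eval_X] at this
      simp only [Z, map_mul, map_sub, eval_X, map_zero]
      rw [this, h1 _ _ hv, zero_mul]
  have := algHom_aeval_quinCoef (aeval fun o : Option (Fin 5) => o.elim t z) (X none) Z h
  rw [(mul_eq_zero.1 hP).resolve_right hne, map_zero] at this
  simpa [Z, aeval_eq_eval] using this.symm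

theorem exists_quinCoef (a : Fin 7 → ℂ) (ha0 : a 0 = 0) (ha1 : a 1 ≠ 0) :
    ∃ z, a = quinCoef (a 1) z := by
  let p : Polynomial ℂ := .C (a 1) * .X ^ 5 + .C (a 2) * .X ^ 4 + .C (a 3) * .X ^ 3 +
    .C (a 4) * .X ^ 2 + .C (a 5) * .X + .C (a 6)
  have hdeg : p.natDegree = 5 := by
    simp only [p]
    compute_degree!
  have hlead : p.leadingCoeff = a 1 := by
    rw [Polynomial.leadingCoeff, hdeg]
    simp [p]
  have hsplit := IsAlgClosed.splits p
  have hprod := hsplit.eq_prod_roots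
  have hcard : p.roots.card = 5 := by rw [← hsplit.natDegree_eq_card_roots, hdeg]
  obtain ⟨z, hz⟩ : ∃ z : Fin 5 → ℂ, p.roots = Multiset.map z Finset.univ.val := by
    obtain ⟨l, hl⟩ := Quot.exists_rep p.roots
    have hlen : l.length = 5 := by
      rw [← hcard, ← hl]
      rfl
    obtain ⟨z, rfl⟩ : ∃ z : Fin 5 → ℂ, l = List.ofFn z := by
      rw [← hlen]
      exact ⟨l.get, (List.ofFn_get l).symm⟩
    exact ⟨z, by rw [← hl, Fin.univ_val_map]; rfl⟩
  rw [hlead, hz, Multiset.map_map] at hprod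
  have hprod' : p = .C (a 1) * ∏ i, (.X - .C (z i)) := hprod
  refine ⟨z, ?_⟩
  have hcoef : p = .C (quinCoef (a 1) z 1) * .X ^ 5 + .C (quinCoef (a 1) z 2) * .X ^ 4 +
      .C (quinCoef (a 1) z 3) * .X ^ 3 + .C (quinCoef (a 1) z 4) * .X ^ 2 +
      .C (quinCoef (a 1) z 5) * .X + .C (quinCoef (a 1) z 6) := by
    rw [hprod']
    simp [quinCoef, Fin.prod_univ_succ]
    ring
  have hk (k : ℕ) := congrArg (Polynomial.coeff · k) hcoef
  funext k
  fin_cases k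
  · exact ha0
  · rfl
  · simpa [p, Polynomial.coeff_X, Polynomial.coeff_C] using hk 4
  · simpa [p, Polynomial.coeff_X, Polynomial.coeff_C] using hk 3
  · simpa [p, Polynomial.coeff_X, Polynomial.coeff_C] using hk 2
  · simpa [p, Polynomial.coeff_X, Polynomial.coeff_C] using hk 1
  · simpa [p, Polynomial.coeff_X, Polynomial.coeff_C] using hk 0

/-- The substitution moving the zero `(r : 1)` of a form to `(1 : 0)`. -/
def rootElt (r : ℂ) : Matrix.SpecialLinearGroup (Fin 2) ℂ := ⟨!![r, -1; 1, 0], by simp⟩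

theorem sl2Act_rootElt_zero (r : ℂ) (a : Fin 7 → ℂ) :
    sl2Act 6 (rootElt r) a 0 = ∑ i, a i * r ^ (6 - (i : ℕ)) := by
  have h1 (b : Fin 7 → ℂ) : eval ![1, 0] (formPoly 6 b) = b 0 := by
    simp [formPoly, Fin.sum_univ_succ]
  have h2 (q : MvPolynomial (Fin 2) ℂ) :
      eval ![1, 0] (linSubst (rootElt r) q) = eval ![r, 1] q := by
    have : (aeval ![(1 : ℂ), 0]).comp (linSubst (rootElt r)) = aeval ![r, 1] := by
      apply MvPolynomial.algHom_ext
      intro j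
      fin_cases j <;> simp [linSubst, rootElt]
    exact DFunLike.congr_fun this q
  rw [← h1 (sl2Act 6 (rootElt r) a), formPoly_sl2Act, h2]
  simp [formPoly]

theorem eq_zero_of_eval_slice (hh : h ∈ invariantRing 6)
    (h0 : ∀ t a b c : ℂ, eval (quinCoef t ![0, 1, a, b, c]) h = 0) : h = 0 := by
  have h1 (a : Fin 7 → ℂ) (ha0 : a 0 = 0) : eval a h = 0 := by
    let P : MvPolynomial (Fin 6) ℂ := aeval (Fin.cons 0 X : Fin 7 → MvPolynomial (Fin 6) ℂ) h
    have hP (v : Fin 6 → ℂ) : eval v P = eval (Fin.cons 0 v : Fin 7 → ℂ) h := by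
      have : (aeval v).comp (aeval (Fin.cons 0 X : Fin 7 → MvPolynomial (Fin 6) ℂ)) =
          aeval (Fin.cons 0 v : Fin 7 → ℂ) := by
        apply MvPolynomial.algHom_ext
        intro j
        refine Fin.cases ?_ (fun j => ?_) j <;> simp
      exact DFunLike.congr_fun this h
    have hPX : P * X 0 = 0 := by
      apply MvPolynomial.funext
      intro v
      by_cases hv : v 0 = 0
      · simp [hv]
      · obtain ⟨z, hz⟩ := exists_quinCoef (Fin.cons 0 v : Fin 7 → ℂ) rfl hv
        rw [map_mul, hP, hz, eval_quinCoef_eq_zero hh h0]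
        simp
    have ha : a = Fin.cons 0 (Fin.tail a) := by
      rw [← ha0, Fin.cons_self_tail]
    rw [ha, ← hP, (mul_eq_zero.1 hPX).resolve_right (X_ne_zero _), map_zero]
  apply MvPolynomial.funext
  intro a
  rw [map_zero]
  by_cases ha0 : a 0 = 0
  · exact h1 a ha0
  let p : Polynomial ℂ := .C (a 0) * .X ^ 6 + .C (a 1) * .X ^ 5 + .C (a 2) * .X ^ 4 +
    .C (a 3) * .X ^ 3 + .C (a 4) * .X ^ 2 + .C (a 5) * .X + .C (a 6)
  have hdeg : p.natDegree = 6 := by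
    simp only [p]
    compute_degree!
  obtain ⟨r, hr⟩ := IsAlgClosed.exists_root p (by
    intro e
    rw [Polynomial.natDegree_eq_of_degree_eq_some e] at hdeg
    simp at hdeg)
  rw [← hh (rootElt r) a]
  apply h1
  rw [sl2Act_rootElt_zero]
  simp [p] at hr
  simp [Fin.sum_univ_succ]
  linear_combination hr

end Injectivity

section FiniteIntegralClosure

variable {k K : Type*} [Field k] [Field K] [Algebra k K]

theorem isIntegral_adjoin_of_forall_valuationSubring {s : Set K} {y : K}
    (hy : ∀ O : ValuationSubring K, (∀ z : k, algebraMap k K z ∈ O) → (∀ x ∈ s, x ∈ O) → y ∈ O) :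
    IsIntegral (Algebra.adjoin k s) y := by
  let A := Subring.closure (Set.range (algebraMap k K) ∪ s)
  have hA : IsIntegral A y := by
    have hmem : y ∈ (integralClosure A K).toSubring := by
      rw [← iInf_valuationSubring_superset]
      simp only [Subring.mem_iInf]
      rintro ⟨O, hO⟩
      exact hy O (fun z => hO (Or.inl ⟨z, rfl⟩)) fun x hx => hO (Or.inr hx)
    exact hmem
  have hle : A ≤ (Algebra.adjoin k s).toSubring := by
    rw [Algebra.adjoin_eq_ring_closure]
  exact hA.map_of_comp_eq (Subring.inclusion hle) (RingHom.id K) rfl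

theorem finiteDimensional_of_adjoin_eq_top (F : IntermediateField k K) {T : Set K}
    (hfin : T.Finite) (hT : IntermediateField.adjoin k T = ⊤)
    (hTalg : ∀ y ∈ T, IsAlgebraic F y) : FiniteDimensional F K := by
  have hfinT : Finite T := hfin
  have hfd : FiniteDimensional F (IntermediateField.adjoin F T) :=
    IntermediateField.finiteDimensional_adjoin fun y hy => (hTalg y hy).isIntegral
  have htop : IntermediateField.adjoin F T = ⊤ := by
    rw [eq_top_iff]
    intro y _
    have h1 : IntermediateField.adjoin k T ≤
        (IntermediateField.adjoin F T).restrictScalars k :=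
      IntermediateField.adjoin_le_iff.2 (IntermediateField.subset_adjoin F T)
    exact h1 (hT ▸ IntermediateField.mem_top)
  rw [htop] at hfd
  exact IntermediateField.topEquiv.toLinearEquiv.finiteDimensional

open scoped IntermediateField.algebraAdjoinAdjoin

theorem isNoetherian_integralClosure_adjoin [CharZero k] {ι : Type*} [Finite ι] {x : ι → K}
    (hx : AlgebraicIndependent k x)
    (hfd : FiniteDimensional (IntermediateField.adjoin k (Set.range x)) K) :
    IsNoetherian (Algebra.adjoin k (Set.range x))
      (integralClosure (Algebra.adjoin k (Set.range x)) K) := by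
  have : IsNoetherianRing (Algebra.adjoin k (Set.range x)) :=
    isNoetherianRing_of_ringEquiv _ hx.aevalEquiv.toRingEquiv
  have : IsIntegrallyClosed (Algebra.adjoin k (Set.range x)) :=
    .of_equiv hx.aevalEquiv.toRingEquiv
  have : CharZero (IntermediateField.adjoin k (Set.range x)) :=
    charZero_of_injective_algebraMap (algebraMap k _).injective
  exact IsIntegralClosure.isNoetherian _ (IntermediateField.adjoin k (Set.range x)) K _

theorem algebraicIndependent_of_finiteDimensional {ι : Type*} [Finite ι] {x v : ι → K}
    (hfd : FiniteDimensional (IntermediateField.adjoin k (Set.range x)) K)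
    (hv : AlgebraicIndependent k v) : AlgebraicIndependent k x := by
  have : Algebra.IsAlgebraic (Algebra.adjoin k (Set.range x)) K :=
    .trans _ (IntermediateField.adjoin k (Set.range x)) _
  exact (Algebra.IsAlgebraic.isTranscendenceBasis_of_lift_le_trdeg_of_finite k x hv.lift_cardinalMk_le_trdeg).1

theorem finite_adjoin_of_isIntegral {R : Type*} [CommRing R] [Algebra k R] {φ : R →ₐ[k] K}
    (hφ : Function.Injective φ) {s : Set R}
    (hN : IsNoetherian (Algebra.adjoin k (φ '' s)) (integralClosure (Algebra.adjoin k (φ '' s)) K))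
    (hintegral : ∀ r, IsIntegral (Algebra.adjoin k (φ '' s)) (φ r)) :
    Module.Finite (Algebra.adjoin k s) R := by
  have hle : Algebra.adjoin k (φ '' s) ≤ φ.range := by
    rw [← AlgHom.map_adjoin]
    rintro _ ⟨r, _, rfl⟩
    exact ⟨r, rfl⟩
  let e₂ : R ≃ₐ[k] φ.range := AlgEquiv.ofInjective φ hφ
  let e₁ : Algebra.adjoin k s ≃ₐ[k] Algebra.adjoin k (φ '' s) :=
    ((Algebra.adjoin k s).equivMapOfInjective φ hφ).trans
      (Subalgebra.equivOfEq _ _ (AlgHom.map_adjoin φ s))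
  let : Algebra (Algebra.adjoin k (φ '' s)) φ.range := (Subalgebra.inclusion hle).toAlgebra
  let g : φ.range →ₗ[Algebra.adjoin k (φ '' s)]
      integralClosure (Algebra.adjoin k (φ '' s)) K :=
    { toFun := fun y => ⟨y, by obtain ⟨_, r, rfl⟩ := y; exact hintegral r⟩
      map_add' := fun _ _ => rfl
      map_smul' := fun _ _ => rfl }
  have hg : Function.Injective g := fun y z hyz => by
    exact Subtype.ext (congrArg (algebraMap _ K) hyz)
  have : IsNoetherian (Algebra.adjoin k (φ '' s)) φ.range := isNoetherian_of_injective g hg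
  refine Module.Finite.of_equiv_equiv e₁.symm.toRingEquiv e₂.symm.toRingEquiv ?_
  ext y
  obtain ⟨y, rfl⟩ := e₁.surjective y
  apply e₂.injective
  simp
  rfl

theorem algebraicIndependent_and_finite_of_isIntegral [CharZero k] {R : Type*} [CommRing R]
    [Algebra k R] {φ : R →ₐ[k] K} (hφ : Function.Injective φ) {ι : Type*} [Finite ι] {p : ι → R}
    {T : Set K} (hfin : T.Finite) (hT : IntermediateField.adjoin k T = ⊤)
    (hTalg : ∀ y ∈ T, IsAlgebraic (IntermediateField.adjoin k (Set.range (φ ∘ p))) y)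
    {v : ι → K} (hv : AlgebraicIndependent k v)
    (hintegral : ∀ r, IsIntegral (Algebra.adjoin k (Set.range (φ ∘ p))) (φ r)) :
    AlgebraicIndependent k p ∧ Module.Finite (Algebra.adjoin k (Set.range p)) R := by
  have hfd := finiteDimensional_of_adjoin_eq_top _ hfin hT hTalg
  have hx := algebraicIndependent_of_finiteDimensional hfd hv
  have hN := isNoetherian_integralClosure_adjoin hx hfd
  rw [Set.range_comp] at hN hintegral
  exact ⟨.of_comp φ hx, finite_adjoin_of_isIntegral hφ hN hintegral⟩

end FiniteIntegralClosure

section SliceField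

/-- The function field of the slice `t y x (x - y) (x - a y) (x - b y) (x - c y)`. -/
abbrev SliceField : Type := FractionRing (MvPolynomial (Fin 4) ℂ)

/-- The coordinates `t, a, b, c` of the slice. -/
def sliceVar (i : Fin 4) : SliceField := algebraMap (MvPolynomial (Fin 4) ℂ) SliceField (X i)

theorem algebraicIndependent_sliceVar : AlgebraicIndependent ℂ sliceVar :=
  (algebraicIndependent_X (Fin 4) ℂ).map' (f := IsScalarTower.toAlgHom ℂ _ SliceField)
    (IsFractionRing.injective _ _)

theorem adjoin_range_sliceVar : IntermediateField.adjoin ℂ (Set.range sliceVar) = ⊤ := by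
  rw [eq_top_iff]
  intro y _
  obtain ⟨p, q, _, rfl⟩ := IsFractionRing.div_surjective (A := MvPolynomial (Fin 4) ℂ) y
  have h (p : MvPolynomial (Fin 4) ℂ) :
      algebraMap _ SliceField p ∈ IntermediateField.adjoin ℂ (Set.range sliceVar) := by
    induction p using MvPolynomial.induction_on with
    | C z =>
      rw [← MvPolynomial.algebraMap_eq, ← IsScalarTower.algebraMap_apply]
      exact algebraMap_mem _ z
    | add p q hp hq => rw [map_add]; exact add_mem hp hq
    | mul_X p i hp =>
      rw [map_mul]
      exact mul_mem hp (IntermediateField.subset_adjoin _ _ ⟨i, rfl⟩)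
  exact div_mem (h p) (h q)

theorem injective_sliceRoots :
    Function.Injective (![0, 1, sliceVar 1, sliceVar 2, sliceVar 3] : Fin 5 → SliceField) := by
  have h : (![0, 1, sliceVar 1, sliceVar 2, sliceVar 3] : Fin 5 → SliceField) =
      algebraMap (MvPolynomial (Fin 4) ℂ) SliceField ∘ ![0, 1, X 1, X 2, X 3] := by
    funext i
    fin_cases i <;> simp [sliceVar]
  rw [h]
  refine (IsFractionRing.injective _ _).comp fun i j hij => ?_
  have := congrArg (eval ![(0 : ℂ), 2, 3, 4]) hij
  fin_cases i <;> fin_cases j <;> simp at this ⊢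

/-- The coefficients of the generic form of the slice. -/
def genericSlice : Fin 7 → SliceField :=
  sliceCoef (sliceVar 0) (sliceVar 1) (sliceVar 2) (sliceVar 3)

/-- Restriction of invariants to the slice. -/
def restrictSlice : invariantRing 6 →ₐ[ℂ] SliceField :=
  (aeval genericSlice).comp (invariantRing 6).val

theorem restrictSlice_injective : Function.Injective restrictSlice := by
  rw [injective_iff_map_eq_zero]
  rintro ⟨h, hh⟩ h0
  have h1 := algHom_aeval_quinCoef (IsScalarTower.toAlgHom ℂ (MvPolynomial (Fin 4) ℂ) SliceField)
    (X 0) ![0, 1, X 1, X 2, X 3] h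
  have hz : (fun p => IsScalarTower.toAlgHom ℂ (MvPolynomial (Fin 4) ℂ) SliceField
      ((![0, 1, X 1, X 2, X 3] : Fin 5 → MvPolynomial (Fin 4) ℂ) p)) =
      ![0, 1, sliceVar 1, sliceVar 2, sliceVar 3] := by
    funext i
    fin_cases i <;> simp [sliceVar]
  have h2 : aeval genericSlice h = 0 := h0
  rw [genericSlice, sliceCoef_eq_quinCoef] at h2
  rw [hz] at h1
  have h3 := (map_eq_zero_iff _ (IsFractionRing.injective (MvPolynomial (Fin 4) ℂ) SliceField)).1
    (h1.trans h2)
  refine Subtype.ext (eq_zero_of_eval_slice hh fun t a b c => ?_)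
  have h4 := algHom_aeval_quinCoef (aeval ![t, a, b, c]) (X 0) ![0, 1, X 1, X 2, X 3] h
  rw [h3, map_zero] at h4
  have hz' : (fun p => (aeval ![t, a, b, c])
      ((![0, 1, X 1, X 2, X 3] : Fin 5 → MvPolynomial (Fin 4) ℂ) p)) = ![0, 1, a, b, c] := by
    funext i
    fin_cases i <;> simp
  rw [hz'] at h4
  simpa [aeval_eq_eval] using h4.symm

open scoped IntermediateField.algebraAdjoinAdjoin in
theorem isHSOP_of_valuationSubring {d : Fin (6 - 2) → ℕ} {p : Fin (6 - 2) → invariantRing 6}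
    (hd : ∀ k, 0 < d k) (hp : ∀ k, (p k : MvPolynomial (Fin 7) ℂ).IsHomogeneous (d k))
    (hO : ∀ O : ValuationSubring SliceField, (∀ z : ℂ, algebraMap ℂ SliceField z ∈ O) →
      (∀ k, restrictSlice (p k) ∈ O) → inv2 genericSlice ∈ O ∧ inv4 genericSlice ∈ O ∧
        inv6 genericSlice ∈ O ∧ inv10 genericSlice ∈ O) :
    IsHSOP 6 d p := by
  refine ⟨hd, hp, ?_⟩
  let F := IntermediateField.adjoin ℂ (Set.range (restrictSlice ∘ p))
  have hroots := injective_sliceRoots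
  have hmatch {i j k l : Fin 5} (hij : i ≠ j) (hik : i ≠ k) (hil : i ≠ l) (hjk : j ≠ k)
      (hjl : j ≠ l) (hkl : k ≠ l) :
      sliceVar 0 * ((![0, 1, sliceVar 1, sliceVar 2, sliceVar 3] : Fin 5 → SliceField) i -
        (![0, 1, sliceVar 1, sliceVar 2, sliceVar 3] : Fin 5 → SliceField) j) *
        ((![0, 1, sliceVar 1, sliceVar 2, sliceVar 3] : Fin 5 → SliceField) k -
        (![0, 1, sliceVar 1, sliceVar 2, sliceVar 3] : Fin 5 → SliceField) l) ∈
        algebraicClosure F SliceField := by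
    rw [mem_algebraicClosure_iff]
    refine IsIntegral.isAlgebraic (IsIntegral.tower_top
      (R := Algebra.adjoin ℂ (Set.range (restrictSlice ∘ p))) ?_)
    refine isIntegral_adjoin_of_forall_valuationSubring fun O hC hs => ?_
    obtain ⟨hA, hB, hG, hD⟩ := hO O hC fun k => hs _ ⟨k, rfl⟩
    exact matching_mem hC hA hB hG hD hij hik hil hjk hjl hkl
  have ht0 : sliceVar 0 ≠ 0 := algebraicIndependent_sliceVar.ne_zero 0
  have hne {i j : Fin 5} (hij : i ≠ j) := sub_ne_zero.2 (hroots.ne hij)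
  have h23 : sliceVar 1 - sliceVar 2 ≠ 0 := hne (i := 2) (j := 3) (by decide)
  have h24 : sliceVar 1 - sliceVar 3 ≠ 0 := hne (i := 2) (j := 4) (by decide)
  have h34 : sliceVar 2 - sliceVar 3 ≠ 0 := hne (i := 3) (j := 4) (by decide)
  have ha : sliceVar 1 ∈ algebraicClosure F SliceField := by
    convert! div_mem
      (hmatch (i := 0) (j := 2) (k := 3) (l := 4) (by decide) (by decide) (by decide) (by decide)
        (by decide) (by decide))
      (hmatch (i := 0) (j := 1) (k := 3) (l := 4) (by decide) (by decide) (by decide) (by decide)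
        (by decide) (by decide)) using 1
    simp
    field_simp
  have hb : sliceVar 2 ∈ algebraicClosure F SliceField := by
    convert! div_mem
      (hmatch (i := 0) (j := 3) (k := 2) (l := 4) (by decide) (by decide) (by decide) (by decide)
        (by decide) (by decide))
      (hmatch (i := 0) (j := 1) (k := 2) (l := 4) (by decide) (by decide) (by decide) (by decide)
        (by decide) (by decide)) using 1
    simp
    field_simp
  have hc : sliceVar 3 ∈ algebraicClosure F SliceField := by
    convert! div_mem
      (hmatch (i := 0) (j := 4) (k := 2) (l := 3) (by decide) (by decide) (by decide) (by decide)
        (by decide) (by decide))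
      (hmatch (i := 0) (j := 1) (k := 2) (l := 3) (by decide) (by decide) (by decide) (by decide)
        (by decide) (by decide)) using 1
    simp
    field_simp
  have ht : sliceVar 0 ∈ algebraicClosure F SliceField := by
    convert! div_mem
      (hmatch (i := 1) (j := 0) (k := 2) (l := 3) (by decide) (by decide) (by decide) (by decide)
        (by decide) (by decide)) (sub_mem ha hb) using 1
    simp
    field_simp
  refine algebraicIndependent_and_finite_of_isIntegral restrictSlice_injective
    (Set.finite_range sliceVar) adjoin_range_sliceVar ?_ algebraicIndependent_sliceVar ?_
  · rintro _ ⟨i, rfl⟩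
    rw [← mem_algebraicClosure_iff]
    fin_cases i
    exacts [ht, ha, hb, hc]
  · intro h
    refine isIntegral_adjoin_of_forall_valuationSubring fun O hC hs => ?_
    obtain ⟨hA, hB, hG, hD⟩ := hO O hC fun k => hs _ ⟨k, rfl⟩
    exact aeval_sliceCoef_mem hC hA hB hG hD hroots h.2

end SliceField

theorem stmt_15 :
    (∃ p : Fin (6-2) → invariantRing 6, IsHSOP 6 ![2, 4, 6, 10] p) ∧
    (∃ p : Fin (6-2) → invariantRing 6, IsHSOP 6 ![2, 4, 6, 15] p) ∧
    (∃ p : Fin (6-2) → invariantRing 6, IsHSOP 6 ![2, 4, 10, 15] p) := by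
  have e2 : restrictSlice ⟨_, inv2_mem⟩ = inv2 genericSlice := eval_of_natural map_inv2 _
  have e4 : restrictSlice ⟨_, inv4_mem⟩ = inv4 genericSlice := eval_of_natural map_inv4 _
  have e6 : restrictSlice ⟨_, inv6_mem⟩ = inv6 genericSlice := eval_of_natural map_inv6 _
  have e10 : restrictSlice ⟨_, inv10_mem⟩ = inv10 genericSlice := eval_of_natural map_inv10 _
  have e15 : restrictSlice ⟨_, inv15_mem⟩ = inv15 genericSlice := eval_of_natural map_inv15 _
  have h2 := isHomogeneous_inv2
  have h4 := isHomogeneous_inv4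
  have h6 := isHomogeneous_inv6
  have h10 := isHomogeneous_inv10
  have h15 := isHomogeneous_inv15
  refine ⟨⟨![⟨_, inv2_mem⟩, ⟨_, inv4_mem⟩, ⟨_, inv6_mem⟩, ⟨_, inv10_mem⟩],
      isHSOP_of_valuationSubring (fun k => ?_) (fun k => ?_) fun O hC hO => ?_⟩,
    ⟨![⟨_, inv2_mem⟩, ⟨_, inv4_mem⟩, ⟨_, inv6_mem⟩, ⟨_, inv15_mem⟩],
      isHSOP_of_valuationSubring (fun k => ?_) (fun k => ?_) fun O hC hO => ?_⟩,
    ⟨![⟨_, inv2_mem⟩, ⟨_, inv4_mem⟩, ⟨_, inv10_mem⟩, ⟨_, inv15_mem⟩],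
      isHSOP_of_valuationSubring (fun k => ?_) (fun k => ?_) fun O hC hO => ?_⟩⟩
  · fin_cases k <;> simp
  · fin_cases k
    exacts [h2, h4, h6, h10]
  · exact ⟨e2 ▸ hO 0, e4 ▸ hO 1, e6 ▸ hO 2, e10 ▸ hO 3⟩
  · fin_cases k <;> simp
  · fin_cases k
    exacts [h2, h4, h6, h15]
  · have hA : inv2 genericSlice ∈ O := e2 ▸ hO 0
    have hB : inv4 genericSlice ∈ O := e4 ▸ hO 1
    have hG : inv6 genericSlice ∈ O := e6 ▸ hO 2
    have hR : inv15 genericSlice ∈ O := e15 ▸ hO 3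
    exact ⟨hA, hB, hG, inv10_mem_of_inv15_mem hC hA hB hR hG⟩
  · fin_cases k <;> simp
  · fin_cases k
    exacts [h2, h4, h10, h15]
  · have hA : inv2 genericSlice ∈ O := e2 ▸ hO 0
    have hB : inv4 genericSlice ∈ O := e4 ▸ hO 1
    have hD : inv10 genericSlice ∈ O := e10 ▸ hO 2
    have hR : inv15 genericSlice ∈ O := e15 ▸ hO 3
    exact ⟨hA, hB, inv6_mem_of_inv15_mem hC hA hB hR hD, hD⟩
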